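/- arXiv:math/0508358 — 3 statements merged into one kernel-verified Lean document; each statement's English description precedes it below -/
import Mathlib

section
/- Let (R,m) be a complete Noetherian local normal domain of positive prime characteristic p, let P be a height one prime ideal of R, and set S = R/P. If T is a seed over R, then T/PT is a seed over S. -/
open IsLocalRing

universe u v w

/-- `x` is a system of parameters of the local ring `R`: a sequence of `dim R` elements
of the maximal ideal generating an ideal primary to the maximal ideal. -/
def IsSOP (R : Type*) [CommRing R] [IsLocalRing R] {n : ℕ} (x : Fin n → R) : Prop :=
  (n : WithBot ℕ∞) = ringKrullDim R ∧
  (∀ i, x i ∈ maximalIdeal R) ∧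
  (Ideal.span (Set.range x)).radical = maximalIdeal R

/-- The sequence `x` of elements of `R` is a regular sequence on the `R`-module `M`. -/
def IsRegSeq (R : Type*) [CommRing R] (M : Type*) [AddCommGroup M] [Module R M]
    {n : ℕ} (x : Fin n → R) : Prop :=
  RingTheory.Sequence.IsRegular M (List.ofFn x)

/-- `B` is a big Cohen-Macaulay algebra over the local ring `R`: some system of
parameters of `R` is a regular sequence on `B` (and in particular `mB ≠ B`). -/
def IsBigCM (R : Type*) [CommRing R] [IsLocalRing R]
    (B : Type*) [CommRing B] [Algebra R B] : Prop :=
  (∃ (n : ℕ) (x : Fin n → R), IsSOP R x ∧ IsRegSeq R B x) ∧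
  (maximalIdeal R).map (algebraMap R B) ≠ ⊤

/-- `B` is a balanced big Cohen-Macaulay algebra over the local ring `R`: every system of
parameters of `R` is a regular sequence on `B` (and in particular `mB ≠ B`). -/
def IsBalancedBigCM (R : Type*) [CommRing R] [IsLocalRing R]
    (B : Type*) [CommRing B] [Algebra R B] : Prop :=
  (∀ (n : ℕ) (x : Fin n → R), IsSOP R x → IsRegSeq R B x) ∧
  (maximalIdeal R).map (algebraMap R B) ≠ ⊤

/-- `S` is a seed over the local ring `R`: `S` admits an `R`-algebra homomorphism to some
big Cohen-Macaulay `R`-algebra. -/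
def IsSeed (R : Type u) [CommRing R] [IsLocalRing R]
    (S : Type v) [CommRing S] [Algebra R S] : Prop :=
  ∃ (B : Type (max u v)) (_ : CommRing B) (_ : Algebra R B),
    IsBigCM R B ∧ Nonempty (S →ₐ[R] B)

/-- Weak regularity of a list of elements modulo an ideal. -/
def WReg {B : Type*} [CommRing B] : Ideal B → List B → Prop
  | _, [] => True
  | I, x :: xs => (∀ b, x * b ∈ I → b ∈ I) ∧ WReg (I ⊔ Ideal.span {x}) xs

namespace WReg

variable {B : Type*} [CommRing B]

@[simp] theorem nil (I : Ideal B) : WReg I [] := trivial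

theorem cons_iff {I : Ideal B} {x : B} {xs : List B} :
    WReg I (x :: xs) ↔ (∀ b, x * b ∈ I → b ∈ I) ∧ WReg (I ⊔ Ideal.span {x}) xs := Iff.rfl

theorem mem_sup_span {I : Ideal B} {x b : B} :
    b ∈ I ⊔ Ideal.span {x} ↔ ∃ c, b - x * c ∈ I := by
  rw [Submodule.mem_sup]
  constructor
  · rintro ⟨i, hi, j, hj, rfl⟩
    obtain ⟨c, rfl⟩ := Ideal.mem_span_singleton'.1 hj
    exact ⟨c, by convert hi using 1; ring⟩
  · rintro ⟨c, hc⟩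
    exact ⟨_, hc, x * c, Ideal.mul_mem_right _ _ (Ideal.mem_span_singleton_self x), by ring⟩

theorem nzd_swap {I : Ideal B} {x y : B} (hx : ∀ b, x * b ∈ I → b ∈ I)
    (hy : ∀ b, y * b ∈ I ⊔ Ideal.span {x} → b ∈ I ⊔ Ideal.span {x}) (b : B)
    (hb : x * b ∈ I ⊔ Ideal.span {y}) : b ∈ I ⊔ Ideal.span {y} := by
  obtain ⟨c, hc⟩ := mem_sup_span.1 hb
  obtain ⟨d, hd⟩ := mem_sup_span.1 (hy c (mem_sup_span.2 ⟨b, by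
    rw [← I.neg_mem_iff]; convert hc using 1; ring⟩))
  refine mem_sup_span.2 ⟨d, hx _ ?_⟩
  convert I.add_mem hc (I.mul_mem_left y hd) using 1; ring

theorem half_swap {I : Ideal B} {x y : B} {xs : List B} (h : WReg I (x :: y :: xs)) :
    WReg (I ⊔ Ideal.span {y}) (x :: xs) := by
  obtain ⟨hx, hy, hs⟩ := h
  refine ⟨nzd_swap hx hy, ?_⟩
  rwa [sup_right_comm]

theorem append_iff {I : Ideal B} {l l' : List B} :
    WReg I (l ++ l') ↔ WReg I l ∧ WReg (I ⊔ Ideal.ofList l) l' := by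
  induction l generalizing I with
  | nil => simp
  | cons x l ih =>
    simp only [List.cons_append, cons_iff, ih, Ideal.ofList_cons, and_assoc, sup_assoc]

theorem nzd_head {I : Ideal B} {x : B} {xs : List B} (h : WReg I (x :: xs)) (b : B)
    (hb : x * b ∈ I ⊔ Ideal.ofList xs) : b ∈ I ⊔ Ideal.ofList xs := by
  induction xs generalizing I with
  | nil => simpa using h.1 b (by simpa using hb)
  | cons y xs ih =>
    rw [Ideal.ofList_cons, ← sup_assoc] at hb ⊢
    exact ih h.half_swap hb

theorem nzd_pow {I : Ideal B} {x y : B} (hx : ∀ b, x * b ∈ I → b ∈ I)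
    (hy : ∀ b, y * b ∈ I ⊔ Ideal.span {x} → b ∈ I ⊔ Ideal.span {x}) (n : ℕ) (b : B)
    (hb : y * b ∈ I ⊔ Ideal.span {x ^ n}) : b ∈ I ⊔ Ideal.span {x ^ n} := by
  induction n generalizing b with
  | zero => simp
  | succ n ih =>
    obtain ⟨c, hc⟩ := mem_sup_span.1 hb
    obtain ⟨d, hd⟩ := mem_sup_span.1 (hy b (mem_sup_span.2 ⟨x ^ n * c, by convert hc using 1; ring⟩))
    have h1 : x * (y * d - x ^ n * c) ∈ I := by
      convert I.sub_mem hc (I.mul_mem_left y hd) using 1; ring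
    obtain ⟨e, he⟩ := mem_sup_span.1 (ih d (mem_sup_span.2 ⟨c, hx _ h1⟩))
    refine mem_sup_span.2 ⟨e, ?_⟩
    convert I.add_mem hd (I.mul_mem_left x he) using 1; ring

theorem nzd_of_pow {I : Ideal B} {x : B} (hx : ∀ b, x * b ∈ I → b ∈ I) (n : ℕ) (b : B)
    (hb : x ^ n * b ∈ I) : b ∈ I := by
  induction n generalizing b with
  | zero => simpa using hb
  | succ n ih => exact ih _ (hx _ (by convert hb using 1; ring))

theorem pow_ideal {I : Ideal B} {x : B} {xs : List B} (h : WReg I (x :: xs)) (n : ℕ) :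
    WReg (I ⊔ Ideal.span {x ^ n}) xs := by
  induction xs generalizing I with
  | nil => trivial
  | cons y xs ih =>
    refine ⟨nzd_pow h.1 h.2.1 n, ?_⟩
    rw [sup_right_comm]
    exact ih h.half_swap

theorem pow {I : Ideal B} {xs : List B} (h : WReg I xs) (n : ℕ) :
    WReg I (xs.map (· ^ n)) := by
  induction xs generalizing I with
  | nil => trivial
  | cons x xs ih => exact ⟨nzd_of_pow h.1 n, ih (h.pow_ideal n)⟩

theorem colon_prod {I : Ideal B} {xs : List B} (h : WReg I xs) (n : ℕ) (b : B)
    (hb : xs.prod * b ∈ I ⊔ Ideal.ofList (xs.map (· ^ (n + 1)))) :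
    b ∈ I ⊔ Ideal.ofList (xs.map (· ^ n)) := by
  induction xs generalizing I b with
  | nil => simpa using hb
  | cons x xs ih =>
    simp only [List.prod_cons, List.map_cons, Ideal.ofList_cons] at hb ⊢
    rw [sup_comm (Ideal.span _), ← sup_assoc] at hb ⊢
    -- first remove the factor `x`
    obtain ⟨c, hc⟩ := mem_sup_span.1 hb
    have hx := nzd_head (I := I) (x := x) (xs := xs.map (· ^ (n + 1)))
      ⟨h.1, h.2.pow (n + 1)⟩ (xs.prod * b - x ^ n * c) (by convert hc using 1; ring)
    have h2 : xs.prod * b ∈ (I ⊔ Ideal.span {x ^ n}) ⊔ Ideal.ofList (xs.map (· ^ (n + 1))) := by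
      rw [sup_right_comm]; exact mem_sup_span.2 ⟨c, hx⟩
    rw [sup_right_comm]
    exact ih (h.pow_ideal n) _ h2

theorem iff_getElem {I : Ideal B} {l : List B} :
    WReg I l ↔ ∀ i (h : i < l.length) (b : B),
      l[i] * b ∈ I ⊔ Ideal.ofList (l.take i) → b ∈ I ⊔ Ideal.ofList (l.take i) := by
  induction l generalizing I with
  | nil => simp
  | cons x l ih =>
    rw [cons_iff, ih]
    constructor
    · rintro ⟨h0, h⟩ (_ | i) hi b
      · simpa using h0 b
      · simpa [sup_assoc] using h i (by simpa using hi) b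
    · intro h
      refine ⟨fun b hb => by simpa using h 0 (by simp) b (by simpa using hb), fun i hi b hb => ?_⟩
      simpa [sup_assoc] using h (i + 1) (by simpa using hi) b (by simpa [sup_assoc] using hb)

theorem bot_iff_isWeaklyRegular {l : List B} :
    WReg ⊥ l ↔ RingTheory.Sequence.IsWeaklyRegular B l := by
  rw [iff_getElem, RingTheory.Sequence.isWeaklyRegular_iff]
  simp only [isSMulRegular_quotient_iff_mem_of_smul_mem, smul_eq_mul, Ideal.mul_top, bot_sup_eq]

theorem bot_iff_isWeaklyRegular_algebraMap {R : Type*} [CommRing R] [Algebra R B] {l : List R} :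
    WReg (⊥ : Ideal B) (l.map (algebraMap R B)) ↔ RingTheory.Sequence.IsWeaklyRegular B l := by
  rw [bot_iff_isWeaklyRegular, RingTheory.Sequence.isWeaklyRegular_map_algebraMap_iff]

end WReg

/-- The ideal of sequences in `B` that converge to zero in the `M`-adic topology. -/
def nullSeq {B : Type*} [CommRing B] (M : Ideal B) : Ideal (ℕ → B) where
  carrier := {b | ∀ N, ∀ᶠ n in Filter.atTop, b n ∈ M ^ N}
  add_mem' := fun ha hb N => by
    filter_upwards [ha N, hb N] with n h1 h2 using (M ^ N).add_mem h1 h2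
  zero_mem' := fun N => .of_forall fun n => (M ^ N).zero_mem
  smul_mem' := fun c b hb N => by
    filter_upwards [hb N] with n h1 using (M ^ N).mul_mem_left _ h1

/-- Sequences in `B` modulo sequences converging `M`-adically to zero. -/
abbrev SeqMod {B : Type*} [CommRing B] (M : Ideal B) : Type _ := (ℕ → B) ⧸ nullSeq M

namespace SeqMod

variable {B : Type*} [CommRing B] (M : Ideal B)

/-- The diagonal map to sequences modulo null sequences. -/
def diag : B →+* SeqMod M := (Ideal.Quotient.mk _).comp (Pi.constRingHom ℕ B)

theorem mem_map_of_eventually {I : Ideal B} (hI : I.FG) {b : ℕ → B}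
    (h : ∀ N, ∀ᶠ n in Filter.atTop, b n ∈ I ⊔ M ^ N) :
    Ideal.Quotient.mk (nullSeq M) b ∈ I.map (diag M) := by
  classical
  obtain ⟨s, rfl⟩ := hI
  have key : ∀ n, ∃ (c : B → B) (e : B), b n = (∑ x ∈ s, c x * x) + e ∧
      ∀ N ≤ n, b n ∈ Ideal.span (s : Set B) ⊔ M ^ N → e ∈ M ^ N := by
    intro n
    let N₀ := Nat.findGreatest (fun N => b n ∈ Ideal.span (s : Set B) ⊔ M ^ N) n
    have h0 : b n ∈ Ideal.span (s : Set B) ⊔ M ^ N₀ :=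
      Nat.findGreatest_spec (P := fun N => b n ∈ Ideal.span (s : Set B) ⊔ M ^ N)
        (Nat.zero_le n) (by simp)
    obtain ⟨y, hy, e, he, hye⟩ := Submodule.mem_sup.1 h0
    obtain ⟨c, hc⟩ := Submodule.mem_span_finset.1 hy
    refine ⟨c, e, ?_, fun N hN hb => ?_⟩
    · rw [← hye, ← hc.2]; rfl
    · exact Ideal.pow_le_pow_right (Nat.le_findGreatest hN hb) he
  choose c e hce he using key
  have hb : Ideal.Quotient.mk (nullSeq M) b =
      ∑ x ∈ s, Ideal.Quotient.mk (nullSeq M) (fun n => c n x) * diag M x := by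
    have : b = (∑ x ∈ s, (fun n => c n x) * Pi.constRingHom ℕ B x) + e := by
      ext n; simp [hce n]
    conv_lhs => rw [this]
    rw [map_add, map_sum, Ideal.Quotient.eq_zero_iff_mem.2, add_zero]
    · rfl
    · intro N
      filter_upwards [h N, Filter.eventually_ge_atTop N] with n h1 h2 using he n N h2 h1
  rw [hb]
  exact Ideal.sum_mem _ fun x hx =>
    Ideal.mul_mem_left _ _ (Ideal.mem_map_of_mem _ (Ideal.subset_span hx))

theorem eventually_of_mem_map {I : Ideal B} {b : ℕ → B}
    (h : Ideal.Quotient.mk (nullSeq M) b ∈ I.map (diag M)) (N : ℕ) :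
    ∀ᶠ n in Filter.atTop, b n ∈ I ⊔ M ^ N := by
  have h1 : I.map (diag M) =
      (I.map (Pi.constRingHom ℕ B)).map (Ideal.Quotient.mk (nullSeq M)) := by
    rw [diag, Ideal.map_map]
  rw [h1, Ideal.mem_quotient_iff_mem_sup] at h
  obtain ⟨y, hy, e, he, rfl⟩ := Submodule.mem_sup.1 h
  filter_upwards [he N] with n hn
  refine Submodule.add_mem_sup ?_ hn
  have : I.map (Pi.constRingHom ℕ B) ≤ I.comap (Pi.evalRingHom (fun _ : ℕ => B) n) := by
    rw [Ideal.map_le_iff_le_comap]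
    intro x hx
    simpa using hx
  exact this hy

theorem mem_map_of_forall_sup_pow {I : Ideal B} (hI : I.FG) {b : SeqMod M}
    (h : ∀ N, b ∈ (I ⊔ M ^ N).map (diag M)) : b ∈ I.map (diag M) := by
  obtain ⟨b, rfl⟩ := Ideal.Quotient.mk_surjective b
  refine mem_map_of_eventually M hI fun N => ?_
  simpa [sup_assoc] using eventually_of_mem_map M (h N) N

theorem map_ne_top (hM : M ≠ ⊤) : M.map (diag M) ≠ ⊤ := by
  intro h
  have h1 : Ideal.Quotient.mk (nullSeq M) 1 ∈ M.map (diag M) := h ▸ Submodule.mem_top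
  obtain ⟨n, hn⟩ := (eventually_of_mem_map M h1 1).exists
  exact hM ((Ideal.eq_top_iff_one _).2 (by simpa using hn))

theorem wreg_map {I : Ideal B} (hI : I.FG) {l : List B} (hl : ∀ x ∈ l, x ∈ M)
    (hpow : ∀ n, ∃ K, M ^ K ≤ I ⊔ Ideal.ofList (l.map (· ^ (n + 1)))) (h : WReg I l) :
    WReg (I.map (diag M)) (l.map (diag M)) := by
  induction l generalizing I with
  | nil => trivial
  | cons x l ih =>
    have hlN : ∀ N, Ideal.ofList (l.map (· ^ N)) ≤ M ^ N := fun N => by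
      rw [Ideal.ofList, Ideal.span_le]
      intro y hy
      obtain ⟨z, hz, rfl⟩ := List.mem_map.1 hy
      exact Ideal.pow_mem_pow (hl z (List.mem_cons_of_mem _ hz)) _
    refine ⟨fun b hb => ?_, ?_⟩
    · obtain ⟨b, rfl⟩ := Ideal.Quotient.mk_surjective b
      refine mem_map_of_eventually M hI fun N => ?_
      obtain ⟨K, hK⟩ := hpow N
      have hb' : Ideal.Quotient.mk (nullSeq M) (Pi.constRingHom ℕ B x * b) ∈ I.map (diag M) := hb
      filter_upwards [eventually_of_mem_map M hb' K] with n hn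
      have h1 : x * b n ∈ I ⊔ Ideal.ofList ((x :: l).map (· ^ (N + 1))) :=
        (sup_le le_sup_left hK) hn
      rw [List.map_cons, Ideal.ofList_cons, sup_comm (Ideal.span _), ← sup_assoc] at h1
      obtain ⟨c, hc⟩ := WReg.mem_sup_span.1 h1
      have h2 := WReg.nzd_head (I := I) (x := x) (xs := l.map (· ^ (N + 1)))
        ⟨h.1, h.2.pow _⟩ (b n - x ^ N * c) (by convert hc using 1; ring)
      have h3 : b n - x ^ N * c ∈ I ⊔ M ^ N :=
        sup_le_sup_left ((hlN (N + 1)).trans (Ideal.pow_le_pow_right N.le_succ)) I h2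
      have h4 : x ^ N * c ∈ I ⊔ M ^ N := Ideal.mem_sup_right
        (Ideal.mul_mem_right _ _ (Ideal.pow_mem_pow (hl x List.mem_cons_self) N))
      simpa using add_mem h3 h4
    · have h1 : I.map (diag M) ⊔ Ideal.span {diag M x} = (I ⊔ Ideal.span {x}).map (diag M) := by
        rw [Ideal.map_sup, Ideal.map_span, Set.image_singleton]
      rw [h1]
      refine ih (Submodule.FG.sup hI ⟨{x}, by simp⟩) (fun y hy => hl y (List.mem_cons_of_mem _ hy))
        (fun n => ?_) h.2
      obtain ⟨K, hK⟩ := hpow n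
      refine ⟨K, hK.trans ?_⟩
      rw [List.map_cons, Ideal.ofList_cons, ← sup_assoc]
      refine sup_le_sup_right (sup_le_sup_left ?_ _) _
      rw [Ideal.span_singleton_le_span_singleton]
      exact dvd_pow_self x n.succ_ne_zero

end SeqMod

open MvPolynomial in
theorem subsingleton_h1Cotangent_iff_pderiv {F L : Type*} [CommRing F] [CommRing L]
    [Algebra F L] : Subsingleton (Algebra.H1Cotangent F L) ↔
      ∀ f : MvPolynomial L F, aeval (id : L → L) f = 0 →
        (∀ i, aeval (id : L → L) (pderiv i f) = 0) →
        f ∈ RingHom.ker (aeval (R := F) (id : L → L)) ^ 2 := by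
  have hker : (Algebra.Generators.self F L).toExtension.ker =
      RingHom.ker (aeval (R := F) (id : L → L)) :=
    (Algebra.Generators.self F L).ker_eq_ker_aeval_val
  rw [Algebra.H1Cotangent, Algebra.Extension.subsingleton_h1Cotangent, injective_iff_map_eq_zero]
  have hD (f : (Algebra.Generators.self F L).toExtension.ker) :
      (Algebra.Generators.self F L).toExtension.cotangentComplex (.mk f) = 0 ↔
        ∀ i, aeval (id : L → L) (pderiv i (show MvPolynomial L F from f.1)) = 0 := by
    rw [Algebra.Extension.cotangentComplex_mk,
      ← (Algebra.Generators.self F L).cotangentSpaceBasis.repr.map_eq_zero_iff,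
      DFunLike.ext_iff]
    refine forall_congr' fun i => ?_
    rw [(Algebra.Generators.self F L).cotangentSpaceBasis_repr_one_tmul]
    rfl
  constructor
  · intro h f hf hd
    have hf' : f ∈ (Algebra.Generators.self F L).toExtension.ker := hker.symm ▸ hf
    have := (Algebra.Extension.Cotangent.mk_eq_zero_iff _).1 (h (.mk ⟨f, hf'⟩) ((hD _).2 hd))
    exact hker ▸ this
  · intro h x hx
    obtain ⟨f, rfl⟩ := Algebra.Extension.Cotangent.mk_surjective x
    rw [Algebra.Extension.Cotangent.mk_eq_zero_iff]
    have hf : aeval (id : L → L) (show MvPolynomial L F from f.1) = 0 := f.2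
    exact h f.1 hf ((hD f).1 hx)

open MvPolynomial in
theorem formallySmooth_of_perfectField (F L : Type*) [Field F] [PerfectField F]
    [Field L] [Algebra F L] : Algebra.FormallySmooth F L := by
  refine ⟨inferInstance, subsingleton_h1Cotangent_iff_pderiv.2 fun f hf hd => ?_⟩
  let K := IntermediateField.adjoin F (f.vars : Set L)
  have hK : Algebra.EssFiniteType F K := by
    rw [IntermediateField.essFiniteType_iff]
    exact ⟨f.vars, rfl⟩
  obtain ⟨g, hg⟩ := f.exists_rename_eq_of_vars_subset_range (Subtype.val : K → L)
    Subtype.val_injective (by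
      rw [Subtype.range_coe]
      exact IntermediateField.subset_adjoin F _)
  rw [← hg] at hf hd ⊢
  have hev (q : MvPolynomial K F) : aeval (id : L → L) (rename (Subtype.val : K → L) q) =
      ((aeval (id : K → K) q : K) : L) := by
    rw [aeval_rename]
    exact (MvPolynomial.aeval_algebraMap_apply (A := K) L (id : K → K) q)
  have key := subsingleton_h1Cotangent_iff_pderiv.1
    (inferInstance : Subsingleton (Algebra.H1Cotangent F K)) g
    (by rw [hev] at hf; exact_mod_cast hf) (fun i => by
      have := hd i
      rw [pderiv_rename Subtype.val_injective, hev] at this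
      exact_mod_cast this)
  have hle : (RingHom.ker (aeval (R := F) (id : K → K))).map (rename (R := F) (Subtype.val : K → L))
      ≤ RingHom.ker (aeval (R := F) (id : L → L)) := by
    rw [Ideal.map_le_iff_le_comap]
    intro q hq
    have hq' : aeval (id : K → K) q = 0 := hq
    change aeval (id : L → L) (rename _ q) = 0
    rw [hev, hq']; rfl
  have := Ideal.mem_map_of_mem (rename (R := F) (Subtype.val : K → L)) key
  rw [Ideal.map_pow] at this
  exact Ideal.pow_right_mono hle 2 this

theorem exists_coefficientField (R : Type*) [CommRing R] [IsLocalRing R]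
    [IsAdicComplete (IsLocalRing.maximalIdeal R) R] (p : ℕ) [Fact p.Prime] [CharP R p] :
    ∃ σ : IsLocalRing.ResidueField R →+* R, ∀ a, IsLocalRing.residue R (σ a) = a := by
  let : Algebra (ZMod p) R := ZMod.algebra R p
  have := formallySmooth_of_perfectField (ZMod p) (IsLocalRing.ResidueField R)
  obtain ⟨g, hg⟩ := Algebra.FormallySmooth.exists_mkₐ_comp_eq_of_isAdicComplete
    (I := IsLocalRing.maximalIdeal R) (AlgHom.id (ZMod p) (IsLocalRing.ResidueField R))
  exact ⟨g.toRingHom, fun a => DFunLike.congr_fun hg a⟩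

theorem MvPowerSeries.ker_constantCoeff_le {σ k : Type*} [Finite σ] [CommRing k]
    (α : MvPowerSeries σ k) (h : MvPowerSeries.constantCoeff α = 0) :
    α ∈ Ideal.span (Set.range (MvPowerSeries.X : σ → MvPowerSeries σ k)) := by
  have h1 : MvPowerSeries.toAdicCompletion σ k α ∈
      RingHom.ker (AdicCompletion.evalOneₐ (MvPolynomial.idealOfVars σ k)).toRingHom := by
    have : AdicCompletion.evalOneₐ (MvPolynomial.idealOfVars σ k)
        (MvPowerSeries.toAdicCompletion σ k α) =
        Ideal.Quotient.mk _ (MvPowerSeries.truncTotal 1 α) := rfl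
    rw [RingHom.mem_ker]
    refine this.trans (Ideal.Quotient.eq_zero_iff_mem.2 ?_)
    rw [← pow_one (MvPolynomial.idealOfVars σ k), MvPolynomial.mem_pow_idealOfVars_iff']
    intro x hx
    rw [MvPowerSeries.coeff_truncTotal _ hx]
    obtain rfl : x = 0 := by simpa [Finsupp.degree_eq_zero_iff] using hx
    simpa using h
  rw [AdicCompletion.ker_evalOneₐ_eq_map _ (MvPolynomial.idealOfVars_fg σ k)] at h1
  have h2 := Ideal.mem_map_of_mem (MvPowerSeries.toAdicCompletionAlgEquiv σ k).symm.toRingEquiv.toRingHom h1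
  rw [Ideal.map_map] at h2
  replace h2 := (Ideal.map_span _ (Set.range MvPolynomial.X)).le h2
  have h3 : (MvPowerSeries.toAdicCompletionAlgEquiv σ k).symm.toRingEquiv.toRingHom
      (MvPowerSeries.toAdicCompletion σ k α) = α :=
    (MvPowerSeries.toAdicCompletionAlgEquiv σ k).symm_apply_apply α
  rw [h3] at h2
  convert h2 using 1
  rw [← Set.range_comp]
  congr 2
  ext1 i
  exact (MvPolynomial.coe_X (R := k) i).symm.trans
    ((MvPowerSeries.toAdicCompletionAlgEquiv σ k).symm.commutes (MvPolynomial.X i)).symm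

theorem MvPowerSeries.exists_eq_C_add {σ k : Type*} [Finite σ] [CommRing k]
    (α : MvPowerSeries σ k) : ∃ c, ∃ β ∈ Ideal.span (Set.range
      (MvPowerSeries.X : σ → MvPowerSeries σ k)), α = MvPowerSeries.C c + β :=
  ⟨constantCoeff α, α - C (constantCoeff α), ker_constantCoeff_le _ (by simp), by ring⟩

/-- Evaluation of power series at elements of the ideal of definition of a complete ring. -/
theorem MvPowerSeries.exists_eval {σ k R : Type*} [Finite σ] [CommRing k] [CommRing R]
    (m : Ideal R) [IsAdicComplete m R] (s : k →+* R) (x : σ → R) (hx : ∀ i, x i ∈ m) :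
    ∃ ρ : MvPowerSeries σ k →+* R, (∀ c, ρ (C c) = s c) ∧ ∀ i, ρ (X i) = x i := by
  let e := MvPolynomial.eval₂Hom s x
  have he (n : ℕ) : MvPolynomial.idealOfVars σ k ^ n ≤ (m ^ n).comap e := by
    rw [← Ideal.map_le_iff_le_comap, Ideal.map_pow]
    refine Ideal.pow_right_mono ?_ n
    rw [MvPolynomial.idealOfVars, Ideal.map_span, Ideal.span_le]
    rintro _ ⟨_, ⟨i, rfl⟩, rfl⟩
    simpa [e] using hx i
  let f (n : ℕ) : MvPowerSeries σ k →+* R ⧸ m ^ n :=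
    (Ideal.quotientMap (m ^ n) e (he n)).comp (truncTotalAlgHom σ k n).toRingHom
  have hf : ∀ {a b : ℕ} (hle : a ≤ b), (Ideal.Quotient.factorPow m hle).comp (f b) = f a := by
    intro a b hle
    ext α
    change Ideal.Quotient.mk (m ^ a) (e (truncTotal b α)) =
      Ideal.Quotient.mk (m ^ a) (e (truncTotal a α))
    rw [Ideal.Quotient.eq, ← map_sub]
    exact he a (truncTotal_sub_truncTotal_mem_pow_idealOfVars hle le_rfl α)
  have hρ (q : MvPolynomial σ k) :
      IsAdicComplete.liftRingHom m f hf (q : MvPowerSeries σ k) = e q := by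
    rw [← sub_eq_zero]
    refine IsHausdorff.haus (I := m) inferInstance _ fun n => ?_
    rw [SModEq.zero, smul_eq_mul, Ideal.mul_top, ← Ideal.Quotient.eq, 
      IsAdicComplete.mk_liftRingHom]
    have := (truncTotalAlgHom σ k n).commutes q
    have h2 : f n (q : MvPowerSeries σ k) = Ideal.quotientMap (m ^ n) e (he n)
      (Ideal.Quotient.mk _ q) := congrArg (Ideal.quotientMap (m ^ n) e (he n)) this
    rw [h2, Ideal.quotientMap_mk]
  refine ⟨IsAdicComplete.liftRingHom m f hf, fun c => ?_, fun i => ?_⟩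
  · rw [← MvPolynomial.coe_C, hρ]; simp [e]
  · rw [← MvPolynomial.coe_X, hρ]; simp [e]

theorem IsPrecomplete.pi {ι A : Type*} [Finite ι] [CommRing A] (J : Ideal A) [IsPrecomplete J A] :
    IsPrecomplete J (ι → A) := by
  classical
  have := Fintype.ofFinite ι
  have key (n : ℕ) (v : ι → A) : v ∈ (J ^ n • ⊤ : Submodule A (ι → A)) ↔ ∀ i, v i ∈ J ^ n := by
    refine ⟨fun h i => ?_, fun h => ?_⟩
    · refine Submodule.smul_induction_on (p := fun w : ι → A => w i ∈ J ^ n) h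
        (fun r hr w _ => ?_) fun w w' hw hw' => ?_
      · exact (J ^ n).mul_mem_right (w i) hr
      · exact (J ^ n).add_mem hw hw'
    · rw [pi_eq_sum_univ' v]
      exact Submodule.sum_mem _ fun i _ => Submodule.smul_mem_smul (h i) trivial
  refine ⟨fun f hf => ?_⟩
  have h1 (i : ι) : ∃ L : A, ∀ n, f n i ≡ L [SMOD (J ^ n • ⊤ : Submodule A A)] := by
    refine IsPrecomplete.prec inferInstance fun {m n} hmn => ?_
    have := (key m _).1 ((SModEq.sub_mem).1 (hf hmn)) i
    rw [SModEq.sub_mem]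
    simpa using this
  choose L hL using h1
  refine ⟨L, fun n => ?_⟩
  rw [SModEq.sub_mem, key]
  intro i
  have := SModEq.sub_mem.1 (hL i n)
  simpa using this

/-- A form of Nakayama's lemma over a complete ring, without assuming the module finite. -/
theorem Module.Finite.of_sup_smul_eq_top {A N : Type*} [CommRing A] [AddCommGroup N] [Module A N]
    (J : Ideal A) [IsPrecomplete J A] [IsHausdorff J N] (s : Finset N)
    (h : Submodule.span A (s : Set N) ⊔ J • ⊤ = ⊤) : Module.Finite A N := by
  have := IsPrecomplete.pi (ι := s) J
  let f : (s → A) →ₗ[A] N := Fintype.linearCombination A (fun i : s => (i : N))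
  refine Module.Finite.of_surjective f (surjective_of_mkQ_comp_surjective (I := J) fun y => ?_)
  obtain ⟨y, rfl⟩ := Submodule.mkQ_surjective _ y
  obtain ⟨a, ha, b, hb, rfl⟩ := Submodule.mem_sup.1 (h ▸ Submodule.mem_top : y ∈ _)
  have h2 : LinearMap.range f = Submodule.span A (s : Set N) := by
    rw [Fintype.range_linearCombination]
    simp
  rw [← h2] at ha
  obtain ⟨v, rfl⟩ := ha
  exact ⟨v, by simpa using hb⟩

theorem exists_span_sup_pow_eq_top {A R : Type*} [CommRing A] [CommRing R] [Algebra A R]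
    (m : Ideal R) (hm : m.FG) (h : ∀ r : R, ∃ a : A, r - algebraMap A R a ∈ m) (n : ℕ) :
    ∃ s : Finset R, Submodule.span A (s : Set R) ⊔ (m ^ n).restrictScalars A = ⊤ := by
  classical
  induction n with
  | zero => exact ⟨∅, by simp⟩
  | succ n ih =>
    obtain ⟨s, hs⟩ := ih
    obtain ⟨g, hg⟩ := hm.pow (n := n)
    refine ⟨s ∪ g, ?_⟩
    rw [eq_top_iff, ← hs, Finset.coe_union, Submodule.span_union]
    refine sup_le (le_sup_left.trans le_sup_left) fun r hr => ?_
    rw [Submodule.restrictScalars_mem, ← hg] at hr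
    induction hr using Submodule.span_induction with
    | mem x hx =>
      exact Submodule.mem_sup_left (Submodule.mem_sup_right (Submodule.subset_span hx))
    | zero => exact zero_mem _
    | add x y _ _ hx hy => exact add_mem hx hy
    | smul r x hx hx' =>
      obtain ⟨a, ha⟩ := h r
      have h1 : r • x = a • x + (r - algebraMap A R a) * x := by
        rw [smul_eq_mul, Algebra.smul_def]; ring
      rw [h1]
      refine add_mem (Submodule.smul_mem _ _ hx') (Submodule.mem_sup_right ?_)
      rw [Submodule.restrictScalars_mem, pow_succ']
      exact Ideal.mul_mem_mul ha (hg ▸ hx)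

/-- A complete local ring with a coefficient field is finite over a power series ring mapping
onto a sequence generating an ideal primary to the maximal ideal. -/
theorem finite_of_span_X_map {σ k R : Type*} [Finite σ] [Field k] [CommRing R] [IsLocalRing R]
    [IsNoetherianRing R] [Algebra (MvPowerSeries σ k) R]
    (h : ∀ r : R, ∃ c : k, r - algebraMap _ R (MvPowerSeries.C (σ := σ) c) ∈ maximalIdeal R)
    (x : σ → R) (hX : ∀ i, algebraMap (MvPowerSeries σ k) R (MvPowerSeries.X i) = x i)
    (hx : (Ideal.span (Set.range x)).radical = maximalIdeal R) :
    Module.Finite (MvPowerSeries σ k) R := by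
  let J : Ideal (MvPowerSeries σ k) := Ideal.span (Set.range MvPowerSeries.X)
  have hJ : J.map (algebraMap _ R) = Ideal.span (Set.range x) := by
    rw [Ideal.map_span, ← Set.range_comp]
    congr 2
    exact funext hX
  obtain ⟨N, hN⟩ := (Ideal.span (Set.range x)).exists_radical_pow_le_of_fg
    (IsNoetherian.noetherian _)
  obtain ⟨s, hs⟩ := exists_span_sup_pow_eq_top (A := MvPowerSeries σ k) (maximalIdeal R)
    (IsNoetherian.noetherian _) (fun r => (h r).imp' MvPowerSeries.C fun _ => id) N
  have : IsHausdorff (J.map (algebraMap _ R)) R := by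
    refine IsHausdorff.of_isLocalRing _ R (fun htop => ?_)
    have := Ideal.le_radical.trans (hJ ▸ hx).le
    exact (maximalIdeal.isMaximal R).ne_top (top_le_iff.1 (htop ▸ this))
  have : IsHausdorff J R := IsHausdorff.map_algebraMap_iff.1 this
  refine Module.Finite.of_sup_smul_eq_top J s (top_le_iff.1 (hs.ge.trans (sup_le_sup_left ?_ _)))
  rw [Ideal.smul_top_eq_map, hJ, ← hx]
  exact hN

section Functional

variable {σ k B : Type*} [Fintype σ] [Field k] [CommRing B] [Algebra k B] (x : σ → B)

theorem exists_compatible_functionals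
    (hcolon : ∀ n b, (∏ i, x i) * b ∈ Ideal.span (Set.range fun i => x i ^ (n + 1)) →
      b ∈ Ideal.span (Set.range fun i => x i ^ n))
    (hne : Ideal.span (Set.range x) ≠ ⊤) :
    ∃ μ : ℕ → B →ₗ[k] k, μ 0 1 = 1 ∧
      (∀ n, ∀ b ∈ Ideal.span (Set.range fun i => x i ^ (n + 1)), μ n b = 0) ∧
      ∀ n b, μ (n + 1) ((∏ i, x i) * b) = μ n b := by
  let I (n : ℕ) : Ideal B := Ideal.span (Set.range fun i => x i ^ n)
  let L (n : ℕ) := {μ : B →ₗ[k] k // ∀ b ∈ I (n + 1), μ b = 0}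
  have hstep (n : ℕ) (μ : L n) :
      ∃ μ' : L (n + 1), ∀ b, μ'.1 ((∏ i, x i) * b) = μ.1 b := by
    let g : B →ₗ[k] B ⧸ I (n + 2) :=
      (Ideal.Quotient.mkₐ k (I (n + 2))).toLinearMap ∘ₗ LinearMap.mulLeft k (∏ i, x i)
    have h1 : μ.1 ∈ (LinearMap.ker g).dualAnnihilator := by
      rw [Submodule.mem_dualAnnihilator]
      intro b hb
      exact μ.2 b (hcolon _ b (Ideal.Quotient.eq_zero_iff_mem.1 hb))
    rw [← LinearMap.range_dualMap_eq_dualAnnihilator_ker] at h1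
    obtain ⟨ν, hν⟩ := h1
    refine ⟨⟨ν ∘ₗ (Ideal.Quotient.mkₐ k (I (n + 2))).toLinearMap, fun b hb => ?_⟩, fun b => ?_⟩
    · have : Ideal.Quotient.mk (I (n + 2)) b = 0 := Ideal.Quotient.eq_zero_iff_mem.2 hb
      simp [this]
    · exact LinearMap.congr_fun hν b
  have h0 : ∃ μ : L 0, μ.1 1 = 1 := by
    have h1 : Ideal.Quotient.mk (I 1) 1 ≠ 0 := by
      rw [Ne, Ideal.Quotient.eq_zero_iff_mem]
      simpa [I, ← Ideal.eq_top_iff_one] using hne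
    obtain ⟨ν, hν⟩ := Module.Projective.exists_dual_eq_one k h1
    refine ⟨⟨ν ∘ₗ (Ideal.Quotient.mkₐ k (I 1)).toLinearMap, fun b hb => ?_⟩, hν⟩
    have : Ideal.Quotient.mk (I 1) b = 0 := Ideal.Quotient.eq_zero_iff_mem.2 hb
    simp [this]
  choose f hf using hstep
  obtain ⟨μ, hμ⟩ := h0
  let F : (n : ℕ) → L n := fun n => Nat.rec μ f n
  exact ⟨fun n => (F n).1, hμ, fun n => (F n).2, fun n b => hf n (F n) b⟩

theorem exists_linearMap_powerSeries [Algebra (MvPowerSeries σ k) B]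
    [IsScalarTower k (MvPowerSeries σ k) B]
    (hX : ∀ i, algebraMap (MvPowerSeries σ k) B (MvPowerSeries.X i) = x i)
    (hcolon : ∀ n b, (∏ i, x i) * b ∈ Ideal.span (Set.range fun i => x i ^ (n + 1)) →
      b ∈ Ideal.span (Set.range fun i => x i ^ n))
    (hne : Ideal.span (Set.range x) ≠ ⊤) :
    ∃ φ : B →ₗ[MvPowerSeries σ k] MvPowerSeries σ k, φ 1 ≠ 0 := by
  classical
  obtain ⟨μ, hμ1, hμI, hμ⟩ := exists_compatible_functionals (k := k) x hcolon hne
  let mon (n : ℕ) (a : σ →₀ ℕ) : B := ∏ i, x i ^ (n - a i)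
  let φ (b : B) : MvPowerSeries σ k := fun a => μ a.degree (mon a.degree a * b)
  have hφ (a : σ →₀ ℕ) (b : B) (n : ℕ) (hn : a.degree ≤ n) :
      MvPowerSeries.coeff a (φ b) = μ n (mon n a * b) := by
    induction n, hn using Nat.le_induction with
    | base => rfl
    | succ n hn ih =>
      have h1 : mon (n + 1) a = (∏ i, x i) * mon n a := by
        simp only [mon]
        rw [← Finset.prod_mul_distrib]
        refine Finset.prod_congr rfl fun i _ => ?_
        rw [← pow_succ', Nat.succ_sub ((a.le_degree i).trans hn)]
      rw [ih, ← hμ, ← mul_assoc, h1]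
  have hadd (b b' : B) : φ (b + b') = φ b + φ b' := by
    ext a; change μ _ _ = μ _ _ + μ _ _; rw [mul_add, map_add]
  have hC (c : k) (b : B) :
      φ (algebraMap (MvPowerSeries σ k) B (MvPowerSeries.C c) * b) = MvPowerSeries.C c * φ b := by
    have h1 : algebraMap (MvPowerSeries σ k) B (MvPowerSeries.C c) = algebraMap k B c :=
      (IsScalarTower.algebraMap_apply k (MvPowerSeries σ k) B c).symm
    ext a
    rw [MvPowerSeries.coeff_C_mul, h1, ← Algebra.smul_def]
    change μ _ _ = _ * μ _ _
    rw [mul_smul_comm, map_smul, smul_eq_mul]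
  have hXφ (i : σ) (b : B) : φ (x i * b) = MvPowerSeries.X i * φ b := by
    ext a
    rw [MvPowerSeries.X, MvPowerSeries.coeff_monomial_mul, hφ a _ _ le_rfl]
    split_ifs with hle
    · rw [hφ _ b a.degree (Finsupp.degree_mono tsub_le_self), one_mul, ← mul_assoc]
      congr 2
      have h1 : mon a.degree (a - Finsupp.single i 1) =
          (∏ j, x j ^ (a.degree - a j)) * ∏ j, x j ^ (Finsupp.single i 1 j) := by
        rw [← Finset.prod_mul_distrib]
        refine Finset.prod_congr rfl fun j _ => ?_
        rw [← pow_add]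
        congr 1
        have h2 := hle j
        have h3 := a.le_degree j
        simp only [Finsupp.coe_tsub, Pi.sub_apply]
        omega
      rw [h1]
      congr 1
      rw [Finset.prod_eq_single i] <;> simp +contextual [eq_comm]
    · refine hμI _ _ ?_
      have h0 : a i = 0 := by
        by_contra h
        exact hle (by simpa [Nat.one_le_iff_ne_zero] using h)
      have h1 : mon a.degree a = x i ^ a.degree * ∏ j ∈ Finset.univ.erase i, x j ^ (a.degree - a j) := by
        simp only [mon]
        rw [← Finset.mul_prod_erase _ _ (Finset.mem_univ i), h0, Nat.sub_zero]
      rw [h1, show x i ^ a.degree * (∏ j ∈ Finset.univ.erase i, x j ^ (a.degree - a j)) *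
        (x i * b) = (∏ j ∈ Finset.univ.erase i, x j ^ (a.degree - a j)) * b *
          x i ^ (a.degree + 1) by ring]
      exact Ideal.mul_mem_left _ _ (Ideal.subset_span ⟨i, rfl⟩)
  let J : Ideal (MvPowerSeries σ k) := Ideal.span (Set.range MvPowerSeries.X)
  let φ' : B →+ MvPowerSeries σ k := AddMonoidHom.mk' φ hadd
  have hΔ (n : ℕ) : ∀ (α : MvPowerSeries σ k) (b : B),
      φ' (algebraMap _ B α * b) - α * φ' b ∈ J ^ n := by
    induction n with
    | zero => simp
    | succ n ih =>
      intro α b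
      obtain ⟨c, β, hβ, rfl⟩ := α.exists_eq_C_add
      obtain ⟨γ, rfl⟩ := Ideal.mem_span_range_iff_exists_fun.1 hβ
      have h1 : φ' (algebraMap (MvPowerSeries σ k) B
            (MvPowerSeries.C c + ∑ i, γ i * MvPowerSeries.X i) * b) -
          (MvPowerSeries.C c + ∑ i, γ i * MvPowerSeries.X i) * φ' b =
          ∑ i, MvPowerSeries.X i * (φ' (algebraMap (MvPowerSeries σ k) B (γ i) * b) -
            γ i * φ' b) := by
        have h2 : φ' (algebraMap (MvPowerSeries σ k) B (MvPowerSeries.C c) * b) =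
          MvPowerSeries.C c * φ' b := hC c b
        have h3 (i : σ) : φ' (algebraMap (MvPowerSeries σ k) B (γ i) * x i * b) =
            MvPowerSeries.X i * φ' (algebraMap (MvPowerSeries σ k) B (γ i) * b) := by
          rw [mul_comm _ (x i), mul_assoc]
          exact hXφ i _
        simp only [map_add, add_mul, map_sum, map_mul, hX, Finset.sum_mul, h2, h3, mul_sub,
          Finset.sum_sub_distrib, add_sub_add_left_eq_sub]
        congr 1
        exact Finset.sum_congr rfl fun i _ => by ring
      rw [h1, pow_succ']
      exact Ideal.sum_mem _ fun i _ => Ideal.mul_mem_mul (Ideal.subset_span ⟨i, rfl⟩) (ih _ _)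
  refine ⟨⟨φ', fun α b => ?_⟩, fun h => ?_⟩
  · rw [← sub_eq_zero]
    refine IsHausdorff.haus (I := J) inferInstance _ fun n => ?_
    rw [SModEq.zero, smul_eq_mul, Ideal.mul_top, Algebra.smul_def]
    exact hΔ n α b
  · have h1 : MvPowerSeries.coeff 0 (φ 1) = μ 0 (mon 0 0 * 1) := hφ 0 1 0 (by simp)
    have h2 : φ 1 = 0 := h
    rw [h2] at h1
    simp [mon, hμ1] at h1

end Functional

theorem exists_mem_span_of_lt {A M : Type*} [Ring A] [AddCommGroup M] [Module A M]
    [IsNoetherian A M] (v : ℕ → M) :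
    ∃ (N : ℕ) (c : Fin N → A), v N = ∑ i, c i • v i := by
  let f : ℕ →o Submodule A M :=
    ⟨fun n => Submodule.span A (Set.range fun i : Fin n => v i), fun m n h => Submodule.span_mono (by
      rintro _ ⟨i, rfl⟩
      exact ⟨Fin.castLE h i, rfl⟩)⟩
  obtain ⟨N, hN⟩ := monotone_stabilizes_iff_noetherian.2 ‹_› f
  have h1 : v N ∈ f (N + 1) := Submodule.subset_span ⟨Fin.last N, rfl⟩
  rw [← hN (N + 1) N.le_succ] at h1
  obtain ⟨c, hc⟩ := (Submodule.mem_span_range_iff_exists_fun A).1 h1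
  exact ⟨N, c, hc.symm⟩

theorem dvd_of_pow_eq_sum {A R : Type*} [CommRing A] [CommRing R] [IsDomain R]
    [IsIntegrallyClosed R] [Algebra A R] {u t : R} (ht : t ≠ 0)
    {N : ℕ} (c : Fin N → A) (h : u ^ N = ∑ i, algebraMap A R (c i) * u ^ (i : ℕ) * t ^ (N - i)) :
    t ∣ u := by
  let K := FractionRing R
  have ht' : algebraMap R K t ≠ 0 := by simpa using ht
  have h1 : IsIntegral R (algebraMap R K u / algebraMap R K t) := by
    refine ⟨Polynomial.X ^ N - ∑ i, Polynomial.C (algebraMap A R (c i)) * Polynomial.X ^ (i : ℕ),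
      Polynomial.monic_X_pow_sub (Polynomial.degree_sum_fin_lt _), ?_⟩
    simp only [Polynomial.eval₂_sub, Polynomial.eval₂_pow, Polynomial.eval₂_X,
      Polynomial.eval₂_finsetSum, Polynomial.eval₂_mul, Polynomial.eval₂_C]
    rw [sub_eq_zero, div_pow, div_eq_iff (pow_ne_zero _ ht'), ← map_pow, h, map_sum, Finset.sum_mul]
    refine Finset.sum_congr rfl fun i _ => ?_
    have h2 : algebraMap R K t ^ N = algebraMap R K t ^ (i : ℕ) * algebraMap R K t ^ (N - i) := by
      rw [← pow_add, Nat.add_sub_cancel' i.2.le]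
    have h3 : algebraMap R K u ^ (i : ℕ) =
        (algebraMap R K u / algebraMap R K t) ^ (i : ℕ) * algebraMap R K t ^ (i : ℕ) := by
      rw [div_pow, div_mul_cancel₀ _ (pow_ne_zero _ ht')]
    rw [h2, map_mul, map_mul, map_pow, map_pow, h3]
    ring
  obtain ⟨r, hr⟩ := IsIntegrallyClosed.isIntegral_iff.1 h1
  rw [eq_div_iff ht', ← map_mul] at hr
  exact ⟨r, by rw [mul_comm]; exact (IsFractionRing.injective R K hr).symm⟩

/-- If `B` has a nonzero `A`-linear functional, then principal ideals of a normal domain `R`, finite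
over `A`, are contracted from `B`. -/
theorem dvd_of_algebraMap_dvd {A R B : Type*} [CommRing A] [IsDomain A] [IsNoetherianRing A]
    [CommRing R] [IsDomain R] [IsIntegrallyClosed R] [CommRing B] [Algebra A R] [Algebra R B]
    [Algebra A B] [IsScalarTower A R B] [Module.Finite A R] (φ : B →ₗ[A] A) (h : φ 1 ≠ 0)
    {u t : R} (ht : t ≠ 0) (hu : algebraMap R B t ∣ algebraMap R B u) : t ∣ u := by
  obtain ⟨b, hb⟩ := hu
  let L : B →ₗ[A] R →ₗ[A] A :=
    ((LinearMap.mul A B).compl₂ (IsScalarTower.toAlgHom A R B).toLinearMap).compr₂ φ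
  have hL (b : B) (r : R) : L b r = φ (b * algebraMap R B r) := rfl
  obtain ⟨N, c, hc⟩ := exists_mem_span_of_lt (A := A) fun n => L (b ^ n)
  refine dvd_of_pow_eq_sum ht c (sub_eq_zero.1 (by_contra fun hg => ?_))
  set g := u ^ N - ∑ i, algebraMap A R (c i) * u ^ (i : ℕ) * t ^ (N - i) with hgdef
  have h1 : algebraMap R B g = (b ^ N - ∑ i, c i • b ^ (i : ℕ)) * algebraMap R B (t ^ N) := by
    rw [hgdef, map_sub, map_sum, map_pow, hb, sub_mul, map_pow, mul_pow, mul_comm, Finset.sum_mul]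
    congr 1
    refine Finset.sum_congr rfl fun i _ => ?_
    have h2 : algebraMap R B t ^ N = algebraMap R B t ^ (i : ℕ) * algebraMap R B t ^ (N - i) := by
      rw [← pow_add, Nat.add_sub_cancel' i.2.le]
    rw [h2, map_mul, map_mul, map_pow, map_pow, hb, Algebra.smul_def,
      IsScalarTower.algebraMap_apply A R B]
    ring
  obtain ⟨α, hα, r, hr⟩ := (Algebra.IsIntegral.isIntegral (R := A) g).isAlgebraic.exists_nonzero_dvd
    (mem_nonZeroDivisors_of_ne_zero hg)
  have h3 : φ (algebraMap R B (g * r)) = 0 := by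
    rw [map_mul, h1, mul_assoc, ← map_mul, ← hL, map_sub, map_sum, LinearMap.sub_apply, hc]
    simp
  rw [← hr, ← IsScalarTower.algebraMap_apply, Algebra.algebraMap_eq_smul_one, map_smul,
    smul_eq_mul] at h3
  exact (mul_ne_zero hα h) h3

theorem Ideal.ofList_map_ofFn {B : Type*} [CommRing B] {d : ℕ} (x : Fin d → B) (f : B → B) :
    Ideal.ofList ((List.ofFn x).map f) = Ideal.span (Set.range fun i => f (x i)) := by
  rw [Ideal.ofList]
  congr 1
  ext b
  simp [List.mem_ofFn]

theorem WReg.dvd_of_algebraMap_dvd {R : Type*} [CommRing R] [IsDomain R] [IsLocalRing R]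
    [IsNoetherianRing R] [IsAdicComplete (maximalIdeal R) R] [IsIntegrallyClosed R]
    (p : ℕ) [Fact p.Prime] [CharP R p] {d : ℕ} {x : Fin d → R} (hx : ∀ i, x i ∈ maximalIdeal R)
    (hrad : (Ideal.span (Set.range x)).radical = maximalIdeal R)
    {B : Type*} [CommRing B] [Algebra R B]
    (hreg : WReg (⊥ : Ideal B) ((List.ofFn x).map (algebraMap R B)))
    (hB : (maximalIdeal R).map (algebraMap R B) ≠ ⊤)
    {u t : R} (ht : t ≠ 0) (hu : algebraMap R B t ∣ algebraMap R B u) : t ∣ u := by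
  obtain ⟨s, hs⟩ := exists_coefficientField R p
  obtain ⟨ρ, hρC, hρX⟩ := MvPowerSeries.exists_eval (maximalIdeal R) s x hx
  let A := MvPowerSeries (Fin d) (ResidueField R)
  let : Algebra A R := ρ.toAlgebra
  let : Algebra A B := ((algebraMap R B).comp ρ).toAlgebra
  let : Algebra (ResidueField R) B :=
    ((algebraMap R B).comp (ρ.comp (MvPowerSeries.C))).toAlgebra
  have : IsScalarTower A R B := .of_algebraMap_eq' rfl
  have : IsScalarTower (ResidueField R) A B := .of_algebraMap_eq' rfl
  have : IsDomain A := NoZeroDivisors.to_isDomain A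
  have : Module.Finite A R := by
    refine finite_of_span_X_map (fun r => ⟨residue R r, ?_⟩) x hρX hrad
    rw [← residue_eq_zero_iff, map_sub]
    change _ - residue R (ρ _) = 0
    rw [hρC, hs, sub_self]
  have hcolon (n : ℕ) (b : B) (hb : (∏ i, algebraMap R B (x i)) * b ∈
      Ideal.span (Set.range fun i => algebraMap R B (x i) ^ (n + 1))) :
      b ∈ Ideal.span (Set.range fun i => algebraMap R B (x i) ^ n) := by
    rw [List.map_ofFn] at hreg
    have := hreg.colon_prod n b
    rw [Ideal.ofList_map_ofFn, Ideal.ofList_map_ofFn, bot_sup_eq, bot_sup_eq,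
      List.prod_ofFn] at this
    exact this hb
  have hne : Ideal.span (Set.range fun i => algebraMap R B (x i)) ≠ ⊤ := by
    refine fun h => hB (top_le_iff.1 (h.ge.trans (Ideal.span_le.2 ?_)))
    rintro _ ⟨i, rfl⟩
    exact Ideal.mem_map_of_mem _ (hx i)
  obtain ⟨φ, hφ⟩ := exists_linearMap_powerSeries (k := ResidueField R)
    (fun i => algebraMap R B (x i)) (fun i => congrArg _ (hρX i)) hcolon hne
  exact _root_.dvd_of_algebraMap_dvd φ hφ ht hu

namespace IsLocalRing

variable {R : Type*} [CommRing R] [IsLocalRing R]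

/-- The ideals of `B` extended from `R` are closed in the topology defined by the
maximal ideal of `R`. -/
def ExtendedIdealsClosed {B : Type*} [CommRing B] (f : R →+* B) : Prop :=
  ∀ (J : Ideal R) (b : B), (∀ N, b ∈ (J ⊔ maximalIdeal R ^ N).map f) → b ∈ J.map f

theorem exists_notMem_minimalPrimes [IsNoetherianRing R] (I J : Ideal R) :
    ∃ v ∈ maximalIdeal R, (∀ q ∈ I.minimalPrimes, q ≠ maximalIdeal R → v ∉ q) ∧
      ∀ q ∈ J.minimalPrimes, q ≠ maximalIdeal R → v ∉ q := by
  have hfin : ((I.minimalPrimes ∪ J.minimalPrimes) \ {maximalIdeal R}).Finite :=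
    (I.finite_minimalPrimes_of_isNoetherianRing.union
      J.finite_minimalPrimes_of_isNoetherianRing).sdiff
  have hprime (q) (hq : q ∈ (I.minimalPrimes ∪ J.minimalPrimes) \ {maximalIdeal R}) :
      q.IsPrime := hq.1.elim (fun h => h.1.1) (fun h => h.1.1)
  have h1 : ¬ ((maximalIdeal R : Set R) ⊆
      ⋃ q ∈ (I.minimalPrimes ∪ J.minimalPrimes) \ {maximalIdeal R}, (q : Set R)) := by
    intro h
    obtain ⟨q, hq, hle⟩ := ((maximalIdeal R).subset_union_prime_finite hfin (f := id) ⊥ ⊥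
      fun q hq _ _ => hprime q hq).1 h
    have := hprime q hq
    exact hq.2 ((maximalIdeal.isMaximal R).eq_of_le this.ne_top hle).symm
  obtain ⟨v, hv, hv'⟩ := Set.not_subset.1 h1
  simp only [Set.mem_iUnion, not_exists] at hv'
  exact ⟨v, hv, fun q hq hne => hv' q ⟨Or.inl hq, hne⟩, fun q hq hne => hv' q ⟨Or.inr hq, hne⟩⟩

theorem radical_eq_maximalIdeal {I : Ideal R} (hI : I ≤ maximalIdeal R)
    (h : ∀ q : Ideal R, q.IsPrime → I ≤ q → q = maximalIdeal R) : I.radical = maximalIdeal R := by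
  refine le_antisymm ((Ideal.IsPrime.radical_le_iff inferInstance).2 hI) ?_
  rw [Ideal.radical_eq_sInf]
  exact le_sInf fun q hq => (h q hq.2 hq.1).ge

theorem eq_maximalIdeal_of_radical_le {I q : Ideal R} (h : I.radical = maximalIdeal R)
    (hq : q.IsPrime) (hle : I ≤ q) : q = maximalIdeal R :=
  le_antisymm (le_maximalIdeal hq.ne_top) (h ▸ hq.radical_le_iff.2 hle)

theorem radical_sup_span_of_notMem_minimalPrimes [IsNoetherianRing R] {I : Ideal R} {a v : R}
    (ha : (I ⊔ Ideal.span {a}).radical = maximalIdeal R) (hv : v ∈ maximalIdeal R)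
    (hv' : ∀ q ∈ I.minimalPrimes, q ≠ maximalIdeal R → v ∉ q) :
    (I ⊔ Ideal.span {v}).radical = maximalIdeal R := by
  have hI : I ≤ maximalIdeal R := (le_sup_left.trans Ideal.le_radical).trans ha.le
  have ham : a ∈ maximalIdeal R :=
    ha ▸ Ideal.le_radical (Ideal.mem_sup_right (Ideal.mem_span_singleton_self a))
  refine radical_eq_maximalIdeal (sup_le hI ?_) fun q hq hle => ?_
  · simpa [Ideal.span_le] using hv
  obtain ⟨q₀, hq₀, hq₀q⟩ := Ideal.exists_minimalPrimes_le (le_sup_left.trans hle)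
  have hprime := hq₀.1.1
  by_contra hne
  have hqm : q < maximalIdeal R := (le_maximalIdeal hq.ne_top).lt_of_ne hne
  have hvq : v ∈ q := hle (Ideal.mem_sup_right (Ideal.mem_span_singleton_self v))
  have hlt : q₀ < q := hq₀q.lt_of_ne fun h =>
    hv' q₀ hq₀ (h ▸ hne) (h ▸ hvq)
  have hmin : maximalIdeal R ∈ (q₀ ⊔ Ideal.span {a}).minimalPrimes := by
    refine ⟨⟨inferInstance, sup_le (le_maximalIdeal hprime.ne_top) (by simpa [Ideal.span_le])⟩,
      fun r hr _ => ?_⟩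
    exact (eq_maximalIdeal_of_radical_le ha hr.1 ((sup_le_sup_right hq₀.1.2 _).trans hr.2)).ge
  have h1 := Ideal.map_height_le_one_of_mem_minimalPrimes hmin
  have hker : RingHom.ker (Ideal.Quotient.mk q₀) = q₀ := Ideal.mk_ker
  have hsurj := Ideal.Quotient.mk_surjective (I := q₀)
  have hp1 : (q.map (Ideal.Quotient.mk q₀)).IsPrime :=
    Ideal.map_isPrime_of_surjective hsurj (hker.trans_le hq₀q)
  have hp2 : ((maximalIdeal R).map (Ideal.Quotient.mk q₀)).IsPrime :=
    Ideal.map_isPrime_of_surjective hsurj (hker.trans_le (le_maximalIdeal hprime.ne_top))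
  have hp0 : (⊥ : Ideal (R ⧸ q₀)).IsPrime := Ideal.isPrime_bot
  have hlt1 : ⊥ < q.map (Ideal.Quotient.mk q₀) := by
    rw [bot_lt_iff_ne_bot, Ne, Ideal.map_eq_bot_iff_le_ker, hker]
    exact hlt.not_ge
  have hlt2 : q.map (Ideal.Quotient.mk q₀) < (maximalIdeal R).map (Ideal.Quotient.mk q₀) := by
    refine (Ideal.map_mono hqm.le).lt_of_ne fun h => hqm.ne ?_
    have := congrArg (Ideal.comap (Ideal.Quotient.mk q₀)) h
    rwa [Ideal.comap_map_of_surjective' _ hsurj, Ideal.comap_map_of_surjective' _ hsurj, hker,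
      sup_of_le_left hq₀q, sup_of_le_left (le_maximalIdeal hprime.ne_top)] at this
  have h2 := Ideal.height_add_one_le_of_lt_of_isPrime hlt1
  have h3 := Ideal.height_add_one_le_of_lt_of_isPrime hlt2
  have h4 : (1 : ℕ∞) + 1 ≤ 1 :=
    (add_le_add_left (le_add_self.trans h2) 1).trans (h3.trans h1)
  exact absurd h4 (by decide)

end IsLocalRing

namespace WReg

variable {R B : Type*} [CommRing R] [IsLocalRing R] [CommRing B] {f : R →+* B}

theorem swap_of_closed (hf : ExtendedIdealsClosed f) {I : Ideal R} {x y : R} {l : List B}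
    (hx : x ∈ maximalIdeal R) (h : WReg (I.map f) (f x :: f y :: l)) :
    WReg (I.map f) (f y :: f x :: l) := by
  refine ⟨fun b hb => ?_, h.half_swap⟩
  have key (n : ℕ) : ∀ b, f y * b ∈ I.map f → b ∈ I.map f ⊔ Ideal.span {f x ^ n} := by
    induction n with
    | zero => simp
    | succ n ih =>
      intro b hb
      obtain ⟨c, hc⟩ := mem_sup_span.1 (h.2.1 b (Ideal.mem_sup_left hb))
      have h1 : f y * c ∈ I.map f := h.1 _ (by
        convert (I.map f).sub_mem hb ((I.map f).mul_mem_left (f y) hc) using 1; ring)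
      obtain ⟨d, hd⟩ := mem_sup_span.1 (ih c h1)
      refine mem_sup_span.2 ⟨d, ?_⟩
      convert (I.map f).add_mem hc ((I.map f).mul_mem_left (f x) hd) using 1; ring
  refine hf I b fun N => ?_
  rw [Ideal.map_sup]
  have hle : Ideal.span {f x ^ N} ≤ (maximalIdeal R ^ N).map f := by
    rw [Ideal.span_singleton_le_iff_mem, ← map_pow]
    exact Ideal.mem_map_of_mem f (Ideal.pow_mem_pow hx N)
  exact sup_le_sup_left hle _ (key N b hb)

theorem perm (hf : ExtendedIdealsClosed f) {l l' : List R} (hl : ∀ x ∈ l, x ∈ maximalIdeal R)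
    (hperm : l.Perm l') {I : Ideal R} (h : WReg (I.map f) (l.map f)) :
    WReg (I.map f) (l'.map f) := by
  have hsup (I : Ideal R) (x : R) : I.map f ⊔ Ideal.span {f x} = (I ⊔ Ideal.span {x}).map f := by
    rw [Ideal.map_sup, Ideal.map_span, Set.image_singleton]
  induction hperm generalizing I with
  | nil => trivial
  | cons x hp ih =>
    rw [List.map_cons, cons_iff, hsup] at h ⊢
    exact ⟨h.1, ih (fun y hy => hl y (List.mem_cons_of_mem _ hy)) h.2⟩
  | swap x y l => exact h.swap_of_closed hf (hl _ (by simp))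
  | trans hp₁ hp₂ ih₁ ih₂ => exact ih₂ (fun x hx => hl x (hp₁.mem_iff.2 hx)) (ih₁ hl h)

theorem exchange_last {R B : Type*} [CommRing R] [CommRing B] {f : R →+* B}
    {I : Ideal R} {l : List R} {a v : R}
    (ha : a ∈ (I ⊔ Ideal.ofList l ⊔ Ideal.span {v}).radical)
    (h : WReg (I.map f) ((l ++ [a]).map f)) : WReg (I.map f) ((l ++ [v]).map f) := by
  rw [List.map_append, append_iff] at h ⊢
  refine ⟨h.1, fun b hb => ?_, trivial⟩
  rw [← Ideal.map_ofList, ← Ideal.map_sup] at hb ⊢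
  obtain ⟨n, hn⟩ := ha
  obtain ⟨c, hc⟩ := mem_sup_span.1 hn
  have h1 := h.2.1
  rw [← Ideal.map_ofList, ← Ideal.map_sup] at h1
  refine nzd_of_pow h1 n b ?_
  have h2 := Ideal.mul_mem_right b _ (Ideal.mem_map_of_mem f hc)
  convert Ideal.add_mem _ h2 (Ideal.mul_mem_left _ (f c) hb) using 1
  simp only [map_sub, map_mul, map_pow]
  ring

/-- Regularity modulo `I` of one system of parameters implies that of all others. -/
theorem exchange [IsNoetherianRing R] (hf : ExtendedIdealsClosed f) {l l' : List R}
    (hlen : l.length = l'.length) {I : Ideal R}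
    (hl : (I ⊔ Ideal.ofList l).radical = maximalIdeal R)
    (hl' : (I ⊔ Ideal.ofList l').radical = maximalIdeal R)
    (h : WReg (I.map f) (l.map f)) : WReg (I.map f) (l'.map f) := by
  have hmem {I : Ideal R} {l : List R} (hl : (I ⊔ Ideal.ofList l).radical = maximalIdeal R) :
      ∀ x ∈ l, x ∈ maximalIdeal R := fun x hx =>
    hl ▸ Ideal.le_radical (Ideal.mem_sup_right (Ideal.subset_span hx))
  induction l using List.reverseRecOn generalizing l' I with
  | nil => rw [List.length_nil, eq_comm, List.length_eq_zero_iff] at hlen; subst hlen; trivial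
  | append_singleton l a ih =>
    obtain rfl | ⟨l', a', rfl⟩ := l'.eq_nil_or_concat'
    · simp at hlen
    have hofList (l : List R) (a : R) :
        Ideal.ofList (l ++ [a]) = Ideal.ofList l ⊔ Ideal.span {a} := by
      rw [Ideal.ofList_append, Ideal.ofList_singleton]
    obtain ⟨v, hv, hvl, hvl'⟩ :=
      exists_notMem_minimalPrimes (I ⊔ Ideal.ofList l) (I ⊔ Ideal.ofList l')
    have hal := hmem hl
    have hal' := hmem hl'
    rw [hofList, ← sup_assoc] at hl hl'
    have hr := radical_sup_span_of_notMem_minimalPrimes hl hv hvl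
    have hr' := radical_sup_span_of_notMem_minimalPrimes hl' hv hvl'
    have h1 := exchange_last (v := v) (hr ▸ hal a (by simp)) h
    have hmem1 : ∀ x ∈ l ++ [v], x ∈ maximalIdeal R := by
      intro x hx
      rcases List.mem_append.1 hx with hx | hx
      · exact hal x (List.mem_append_left _ hx)
      · rwa [List.mem_singleton.1 hx]
    have h2 := h1.perm hf hmem1 (List.perm_append_singleton v l)
    have h3 : I.map f ⊔ Ideal.span {f v} = (I ⊔ Ideal.span {v}).map f := by
      rw [Ideal.map_sup, Ideal.map_span, Set.image_singleton]
    rw [List.map_cons, cons_iff, h3] at h2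
    have h4 := ih (l' := l') (by simpa using hlen) (by rwa [sup_right_comm])
      (by rwa [sup_right_comm]) h2.2
    have h5 : WReg (I.map f) ((v :: l').map f) := by
      rw [List.map_cons, cons_iff, h3]
      exact ⟨h2.1, h4⟩
    refine exchange_last (hl' ▸ hv) (h5.perm hf (fun x hx => ?_)
      (List.perm_append_singleton v l').symm)
    rcases List.mem_cons.1 hx with rfl | hx
    · exact hv
    · exact hal' x (List.mem_append_left _ hx)

end WReg

namespace IsLocalRing

variable {R : Type*} [CommRing R] [IsLocalRing R]

theorem ringKrullDim_quotient_sup_span_le {I : Ideal R} {v : R} {n : ℕ}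
    (hdim : ringKrullDim (R ⧸ I) ≤ (n + 1 : ℕ))
    (hv' : ∀ q ∈ I.minimalPrimes, q ≠ maximalIdeal R → v ∉ q) :
    ringKrullDim (R ⧸ (I ⊔ Ideal.span {v})) ≤ n := by
  rw [ringKrullDim_quotient] at hdim ⊢
  refine iSup_le fun s => ?_
  have hs0 := s.head.2
  rw [PrimeSpectrum.mem_zeroLocus, SetLike.coe_subset_coe] at hs0
  obtain ⟨q, hq, hqs⟩ := Ideal.exists_minimalPrimes_le (le_sup_left.trans hs0)
  have hqI : (⟨q, hq.1.1⟩ : PrimeSpectrum R) ∈ PrimeSpectrum.zeroLocus (I : Set R) := hq.1.2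
  have hvs : v ∈ s.head.1.asIdeal :=
    hs0 (Ideal.mem_sup_right (Ideal.mem_span_singleton_self v))
  by_cases hs : s.head.1.asIdeal = maximalIdeal R
  · have : s.length = 0 := by
      by_contra hne
      have h1 : s.head < s.last := s.strictMono (by
        rw [Fin.lt_def]; simpa [Nat.pos_iff_ne_zero] using hne)
      have h2 : s.head.1.asIdeal < s.last.1.asIdeal := h1
      exact (hs ▸ h2).not_ge (le_maximalIdeal s.last.1.isPrime.ne_top)
    rw [this]
    exact_mod_cast Nat.zero_le n
  · have hlt : q < s.head.1.asIdeal := by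
      refine hqs.lt_of_ne fun h => hv' q hq (h ▸ hs) (h ▸ hvs)
    let g : PrimeSpectrum.zeroLocus ((I ⊔ Ideal.span {v} : Ideal R) : Set R) →
        PrimeSpectrum.zeroLocus (I : Set R) := fun x => ⟨x.1, by
          have := x.2
          rw [PrimeSpectrum.mem_zeroLocus, SetLike.coe_subset_coe] at this ⊢
          exact le_sup_left.trans this⟩
    let t := (s.map g fun _ _ h => h).cons ⟨⟨q, hq.1.1⟩, hqI⟩ hlt
    have hlen : t.length = s.length + 1 := RelSeries.cons_length _ _ _
    have ht : t.length ≤ n + 1 := by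
      exact_mod_cast (Order.LTSeries.length_le_krullDim t).trans hdim
    have : s.length ≤ n := by omega
    exact_mod_cast this

theorem radical_eq_of_ringKrullDim_quotient_le {I : Ideal R} (hI : I ≤ maximalIdeal R)
    (hdim : ringKrullDim (R ⧸ I) ≤ 0) : I.radical = maximalIdeal R := by
  have : Ring.KrullDimLE 0 (R ⧸ I) := Ring.krullDimLE_iff.2 hdim
  refine radical_eq_maximalIdeal hI fun q hq hle => ?_
  have hsurj := Ideal.Quotient.mk_surjective (I := I)
  have hker : RingHom.ker (Ideal.Quotient.mk I) ≤ q := Ideal.mk_ker.trans_le hle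
  have h1 : (q.map (Ideal.Quotient.mk I)).IsMaximal :=
    (Ideal.map_isPrime_of_surjective hsurj hker).isMaximal'
  have h2 := Ideal.comap_isMaximal_of_surjective _ hsurj (K := q.map (Ideal.Quotient.mk I))
  rw [Ideal.comap_map_of_surjective' _ hsurj, sup_of_le_left hker] at h2
  exact eq_maximalIdeal h2

theorem exists_parameters [IsNoetherianRing R] (n : ℕ) (I : Ideal R) (J : Ideal R)
    (hI : I ≤ maximalIdeal R) (hJ : J ≤ maximalIdeal R) (e : ℕ) (he : e ≤ n)
    (hdimI : ringKrullDim (R ⧸ I) ≤ n) (hdimJ : ringKrullDim (R ⧸ J) ≤ e) :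
    ∃ l l' : List R, l.length = e ∧ (l ++ l').length = n ∧
      (J ⊔ Ideal.ofList l).radical = maximalIdeal R ∧
      (I ⊔ Ideal.ofList (l ++ l')).radical = maximalIdeal R := by
  induction n generalizing I J e with
  | zero =>
    obtain rfl : e = 0 := by omega
    exact ⟨[], [], rfl, rfl, by simpa using radical_eq_of_ringKrullDim_quotient_le hJ hdimJ,
      by simpa using radical_eq_of_ringKrullDim_quotient_le hI hdimI⟩
  | succ n ih =>
    obtain ⟨v, hv, hvI, hvJ⟩ := exists_notMem_minimalPrimes I J
    have hvle : Ideal.span {v} ≤ maximalIdeal R := by simpa [Ideal.span_le] using hv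
    have hI' := ringKrullDim_quotient_sup_span_le hdimI hvI
    cases e with
    | zero =>
      obtain ⟨l, l', hl, hl', h1, h2⟩ := ih _ J (sup_le hI hvle) hJ 0 n.zero_le hI' hdimJ
      obtain rfl := List.length_eq_zero_iff.1 hl
      refine ⟨[], v :: l', rfl, by simpa using hl', h1, ?_⟩
      rw [List.nil_append, Ideal.ofList_cons, ← sup_assoc]
      exact h2
    | succ e =>
      obtain ⟨l, l', hl, hl', h1, h2⟩ := ih _ _ (sup_le hI hvle) (sup_le hJ hvle) e (by omega) hI'
        (ringKrullDim_quotient_sup_span_le hdimJ hvJ)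
      refine ⟨v :: l, l', by simp [hl], by simpa using hl', ?_, ?_⟩
      · rwa [Ideal.ofList_cons, ← sup_assoc]
      · rwa [List.cons_append, Ideal.ofList_cons, ← sup_assoc]

end IsLocalRing

/-- A height one prime of a Noetherian normal domain is generated by one element up to an
element outside of it. -/
theorem Ideal.exists_dvd_mul_of_height_eq_one {R : Type*} [CommRing R] [IsDomain R]
    [IsNoetherianRing R] [IsIntegrallyClosed R] (P : Ideal R) [hP : P.IsPrime]
    (hht : Order.height (⟨P, hP⟩ : PrimeSpectrum R) = 1) :
    ∃ x ∈ P, x ≠ 0 ∧ ∃ y ∉ P, ∀ q ∈ P, x ∣ y * q := by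
  have hmin : ∀ q : Ideal R, q.IsPrime → q ≤ P → q ≠ ⊥ → q = P := by
    intro q hq hqP hq0
    by_contra hne
    have hlt : (⟨q, hq⟩ : PrimeSpectrum R) < ⟨P, hP⟩ := lt_of_le_of_ne hqP fun h => by
      exact hne (congrArg PrimeSpectrum.asIdeal h)
    have h1 : Order.height (⟨q, hq⟩ : PrimeSpectrum R) < 1 := by
      rw [← hht]
      refine Order.height_strictMono hlt ?_
      refine lt_of_le_of_lt (Order.height_mono hlt.le) ?_
      rw [hht]; exact ENat.natCast_lt_top 1
    rw [Order.lt_one_iff, Order.height_eq_zero] at h1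
    have h2 : (⟨⊥, Ideal.isPrime_bot⟩ : PrimeSpectrum R) ≤ ⟨q, hq⟩ := by
      change (⊥ : Ideal R) ≤ q
      exact bot_le
    have h3 : q ≤ ⊥ := h1 h2
    exact hq0 (le_bot_iff.1 h3)
  have hP0 : P ≠ ⊥ := by
    rintro rfl
    have : IsMin (⟨⊥, hP⟩ : PrimeSpectrum R) := fun q _ => by
      change (⊥ : Ideal R) ≤ q.asIdeal
      exact bot_le
    rw [← Order.height_eq_zero, hht] at this
    exact one_ne_zero this
  let A := Localization.AtPrime P
  have hle : P.primeCompl ≤ nonZeroDivisors R := P.primeCompl_le_nonZeroDivisors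
  have hinj : Function.Injective (algebraMap R A) := IsLocalization.injective A hle
  have : IsDomain A := IsLocalization.isDomain_localization hle
  have : IsNoetherianRing A := IsLocalization.isNoetherianRing P.primeCompl A inferInstance
  have : IsIntegrallyClosed A := isIntegrallyClosed_of_isLocalization A P.primeCompl hle
  have hprime : ∀ Q : Ideal A, Q ≠ ⊥ → Q.IsPrime → Q = IsLocalRing.maximalIdeal A := by
    intro Q hQ0 hQ
    have h1 : Q.under R ≤ P := by
      have := Ideal.comap_mono (f := algebraMap R A) (IsLocalRing.le_maximalIdeal hQ.ne_top)
      rwa [← Ideal.under_def, ← Ideal.under_def, Localization.AtPrime.under_maximalIdeal] at this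
    have h2 : Q.under R = P := by
      refine hmin _ (Ideal.IsPrime.comap _) h1 fun h => hQ0 ?_
      rw [← IsLocalization.map_under P.primeCompl A Q, h, Ideal.map_bot]
    rw [← IsLocalization.map_under P.primeCompl A Q, h2, Localization.AtPrime.map_eq_maximalIdeal]
  have hprin : (IsLocalRing.maximalIdeal A).IsPrincipal :=
    (((tfae_of_isNoetherianRing_of_isLocalRing_of_isDomain A).out 3 4 :) : _ ↔ (IsLocalRing.maximalIdeal A).IsPrincipal).1 ⟨inferInstance, hprime⟩
  obtain ⟨g, hg⟩ := hprin
  obtain ⟨⟨x, s⟩, hxs⟩ := IsLocalization.surj P.primeCompl g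
  have hgx : Associated g (algebraMap R A x) :=
    ⟨(IsLocalization.map_units A s).unit, by simpa using hxs⟩
  have hspan : IsLocalRing.maximalIdeal A = Ideal.span {algebraMap R A x} := by
    rw [hg]
    exact Ideal.span_singleton_eq_span_singleton.2 hgx
  have hxP : x ∈ P := by
    rw [← Localization.AtPrime.under_maximalIdeal (I := P), Ideal.under_def, Ideal.mem_comap]
    change algebraMap R A x ∈ IsLocalRing.maximalIdeal A
    rw [hspan]
    exact Ideal.mem_span_singleton_self _
  have hdvd : ∀ q ∈ P, ∃ y ∉ P, x ∣ y * q := by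
    intro q hq
    have h1 : algebraMap R A q ∈ IsLocalRing.maximalIdeal A := by
      rw [← Localization.AtPrime.under_maximalIdeal (I := P), Ideal.under_def, Ideal.mem_comap] at hq
      exact hq
    rw [hspan, Ideal.mem_span_singleton] at h1
    obtain ⟨c, hc⟩ := h1
    obtain ⟨⟨b, t⟩, hbt⟩ := IsLocalization.surj P.primeCompl c
    refine ⟨t, t.2, b, hinj ?_⟩
    rw [map_mul, map_mul, hc, ← hbt]
    ring
  obtain ⟨s, hs⟩ : P.FG := IsNoetherian.noetherian P
  choose! y hy hxy using hdvd
  have hsP : ∀ q ∈ s, q ∈ P := fun q hq => hs ▸ Ideal.subset_span hq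
  refine ⟨x, hxP, ?_, ∏ q ∈ s, y q, ?_, ?_⟩
  · rintro rfl
    refine hP0 (le_bot_iff.1 fun q hq => ?_)
    have h2 := hxy q hq
    rw [zero_dvd_iff, mul_eq_zero] at h2
    rcases h2 with h | h
    · exact absurd (h ▸ P.zero_mem) (hy q hq)
    · exact h
  · rw [hP.prod_mem_iff]
    rintro ⟨q, hq, h⟩
    exact hy q (hsP q hq) h
  · have : P ≤ (Ideal.span {x}).colon ({∏ q ∈ s, y q} : Set R) := by
      rw [← hs]
      refine Ideal.span_le.2 fun q hq => ?_
      rw [SetLike.mem_coe, Submodule.mem_colon_singleton, smul_eq_mul, Ideal.mem_span_singleton]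
      rw [mul_comm]
      exact (hxy q (hsP q hq)).trans (mul_dvd_mul_right (Finset.dvd_prod_of_mem y hq) q)
    intro q hq
    have := this hq
    rwa [Submodule.mem_colon_singleton, smul_eq_mul, Ideal.mem_span_singleton, mul_comm] at this

theorem Pi.mem_ofList_iff {ι D : Type*} [CommRing D] {l : List (ι → D)} {b : ι → D} :
    b ∈ Ideal.ofList l ↔ ∀ i, b i ∈ Ideal.ofList (l.map (· i)) := by
  constructor
  · intro h i
    have := Ideal.mem_map_of_mem (Pi.evalRingHom (fun _ : ι => D) i) h
    rwa [Ideal.map_ofList] at this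
  · induction l generalizing b with
    | nil =>
      intro h
      have : b = 0 := funext fun i => by simpa using h i
      simp [this]
    | cons x l ih =>
      intro h
      have h' : ∀ i, ∃ c, b i - x i * c ∈ Ideal.ofList (l.map (· i)) := fun i => by
        have := h i
        rw [List.map_cons, Ideal.ofList_cons, sup_comm] at this
        exact WReg.mem_sup_span.1 this
      choose c hc using h'
      rw [Ideal.ofList_cons, sup_comm]
      exact WReg.mem_sup_span.2 ⟨c, ih hc⟩

/-- A sequence whose successive colon ideals are killed by `u` becomes weakly regular after
inverting `u`. -/
theorem WReg.localizationAway {A : Type*} [CommRing A] {u : A} {l : List A}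
    (h : ∀ i (hi : i < l.length) (b : A), l[i] * b ∈ Ideal.ofList (l.take i) →
      u * b ∈ Ideal.ofList (l.take i)) :
    WReg (⊥ : Ideal (Localization.Away u)) (l.map (algebraMap A (Localization.Away u))) := by
  rw [WReg.iff_getElem]
  intro i hi b hb
  rw [List.length_map] at hi
  rw [bot_sup_eq, ← List.map_take, ← Ideal.map_ofList] at hb ⊢
  obtain ⟨⟨a, s⟩, has⟩ := IsLocalization.surj (Submonoid.powers u) b
  have hu := IsLocalization.map_units (Localization.Away u) s
  rw [List.getElem_map, ← Ideal.mul_unit_mem_iff_mem _ hu, mul_assoc, has, ← map_mul,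
    IsLocalization.algebraMap_mem_map_algebraMap_iff (Submonoid.powers u)] at hb
  rw [← Ideal.mul_unit_mem_iff_mem _ hu, has,
    IsLocalization.algebraMap_mem_map_algebraMap_iff (Submonoid.powers u)]
  obtain ⟨m, hm, hmem⟩ := hb
  refine ⟨u * m, mul_mem (Submonoid.mem_powers u) hm, ?_⟩
  rw [mul_assoc]
  exact h i hi (m * a) (by convert hmem using 1; ring)

/-- If `w` kills the colon ideals of all Frobenius powers of a sequence, uniformly, and no power
of `w` lies in all the Frobenius powers of the ideal it generates, then the sequence becomes
regular on an algebra. -/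
theorem WReg.exists_of_frobenius {S : Type u} {D : Type v} [CommRing S] [CommRing D] (p : ℕ)
    [ExpChar D p] (g : S →+* D) (w : D) (l : List S)
    (hcolon : ∀ e i (_ : i < l.length) (b : D),
      g l[i] ^ p ^ e * b ∈ Ideal.ofList ((l.take i).map fun z => g z ^ p ^ e) →
      w * b ∈ Ideal.ofList ((l.take i).map fun z => g z ^ p ^ e))
    (hne : ∀ M : ℕ, ∃ e : ℕ, w ^ M ∉ Ideal.ofList (l.map fun z => g z ^ p ^ e)) :
    ∃ (C : Type v) (_ : CommRing C) (φ : D →+* C),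
      WReg (⊥ : Ideal C) (l.map (φ.comp g)) ∧ Ideal.ofList (l.map (φ.comp g)) ≠ ⊤ := by
  let F : D →+* (ℕ → D) := RingHom.pi fun e => iterateFrobenius D p e
  have hF : ∀ (d : D) (e : ℕ), F d e = d ^ p ^ e := fun d e => rfl
  let u : ℕ → D := fun _ => w
  have hmap : l.map (((algebraMap (ℕ → D) (Localization.Away u)).comp F).comp g) =
      (l.map (F.comp g)).map (algebraMap (ℕ → D) (Localization.Away u)) := by
    rw [List.map_map]; rfl
  refine ⟨Localization.Away u, inferInstance, (algebraMap _ _).comp F, ?_, ?_⟩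
  · rw [hmap]
    refine WReg.localizationAway fun i hi b hb => ?_
    rw [List.length_map] at hi
    rw [← List.map_take, Pi.mem_ofList_iff] at hb ⊢
    intro e
    have := hb e
    rw [List.map_map] at this ⊢
    exact hcolon e i hi (b e) (by simpa [hF, Function.comp_def] using this)
  · rw [hmap, ← Ideal.map_ofList, IsLocalization.map_algebraMap_ne_top_iff_disjoint
      (Submonoid.powers u), Set.disjoint_left]
    rintro _ ⟨M, rfl⟩ hM
    obtain ⟨e, he⟩ := hne M
    have := Pi.mem_ofList_iff.1 hM e
    rw [List.map_map] at this
    exact he this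

namespace SeqMod

variable {R : Type*} [CommRing R] [IsLocalRing R] {B : Type*} [CommRing B]
  (f : R →+* B)

theorem extendedIdealsClosed [IsNoetherianRing R] :
    ExtendedIdealsClosed ((diag ((maximalIdeal R).map f)).comp f) := by
  intro J b h
  rw [← Ideal.map_map]
  have hJ : (J.map f).FG := Ideal.FG.map (IsNoetherian.noetherian J) f
  refine mem_map_of_forall_sup_pow ((maximalIdeal R).map f) hJ fun N => ?_
  rw [← Ideal.map_pow, ← Ideal.map_sup, Ideal.map_map]
  exact h N

theorem wreg_map_maximalIdeal [IsNoetherianRing R] {d : ℕ} {x : Fin d → R}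
    (hx : ∀ i, x i ∈ maximalIdeal R)
    (hrad : (Ideal.span (Set.range x)).radical = maximalIdeal R)
    (h : WReg (⊥ : Ideal B) ((List.ofFn x).map f)) :
    WReg (⊥ : Ideal (SeqMod ((maximalIdeal R).map f)))
      ((List.ofFn x).map ((diag ((maximalIdeal R).map f)).comp f)) := by
  have key := wreg_map ((maximalIdeal R).map f) Submodule.fg_bot (l := (List.ofFn x).map f)
    (by
      intro y hy
      obtain ⟨z, hz, rfl⟩ := List.mem_map.1 hy
      obtain ⟨i, rfl⟩ := (List.mem_ofFn' _ _).1 hz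
      exact Ideal.mem_map_of_mem f (hx i)) (by
      intro n
      have h1 : maximalIdeal R ≤
          (Ideal.ofList ((List.ofFn x).map (· ^ (n + 1)))).radical := by
        rw [← hrad, Ideal.radical_le_radical_iff, Ideal.span_le]
        rintro _ ⟨i, rfl⟩
        refine ⟨n + 1, Ideal.subset_span (List.mem_map.2 ⟨x i, ?_, rfl⟩)⟩
        exact (List.mem_ofFn' _ _).2 ⟨i, rfl⟩
      obtain ⟨K, hK⟩ := Ideal.exists_pow_le_of_le_radical_of_fg h1 (IsNoetherian.noetherian _)
      refine ⟨K, ?_⟩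
      rw [bot_sup_eq, ← Ideal.map_pow]
      refine (Ideal.map_mono hK).trans (le_of_eq ?_)
      rw [Ideal.map_ofList, List.map_map, List.map_map]
      congr 2
      ext y
      simp) h
  rw [Ideal.map_bot, List.map_map] at key
  exact key

theorem map_maximalIdeal_ne_top (h : (maximalIdeal R).map f ≠ ⊤) :
    (maximalIdeal R).map ((diag ((maximalIdeal R).map f)).comp f) ≠ ⊤ := by
  rw [← Ideal.map_map]
  exact map_ne_top _ h

end SeqMod

/-- Parameters of `R ⧸ P` that, together with a nonzero element `x` of `P`, are part of a system
of parameters of `R`. -/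
theorem IsLocalRing.exists_parameters_of_mem {R : Type*} [CommRing R] [IsDomain R] [IsLocalRing R]
    [IsNoetherianRing R] (P : Ideal R) [hP : P.IsPrime] {x : R} (hx : x ∈ P) (hx0 : x ≠ 0) {d : ℕ}
    (hd : (d : WithBot ℕ∞) = ringKrullDim R) :
    ∃ l l' : List R, (l.length : WithBot ℕ∞) = ringKrullDim (R ⧸ P) ∧
      (P ⊔ Ideal.ofList l).radical = maximalIdeal R ∧
      (x :: (l ++ l')).length = d ∧ (Ideal.ofList (x :: (l ++ l'))).radical = maximalIdeal R := by
  have hPm : P ≤ maximalIdeal R := le_maximalIdeal hP.ne_top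
  have hxm : Ideal.span {x} ≤ maximalIdeal R := by
    rw [Ideal.span_singleton_le_iff_mem]; exact hPm hx
  obtain ⟨n, rfl⟩ : ∃ n, d = n + 1 := by
    refine ⟨d - 1, (Nat.sub_add_cancel ?_).symm⟩
    rw [Nat.one_le_iff_ne_zero]
    rintro rfl
    have : Ring.KrullDimLE 0 R := by
      rw [Ring.krullDimLE_iff, ← hd]
    have hbot : (⊥ : Ideal R).IsMaximal := Ideal.isPrime_bot.isMaximal'
    have h2 : P = ⊥ := (hbot.eq_of_le hP.ne_top bot_le).symm
    rw [h2, Ideal.mem_bot] at hx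
    exact hx0 hx
  have hdimx : ringKrullDim (R ⧸ Ideal.span {x}) ≤ n := by
    have := ringKrullDim_quotient_sup_span_le (I := (⊥ : Ideal R)) (v := x) (n := n)
      ((ringKrullDim_quotient_le _).trans hd.symm.le) (by
        intro q hq _ hxq
        rw [Ideal.minimalPrimes_eq_subsingleton_self, Set.mem_singleton_iff] at hq
        rw [hq, Ideal.mem_bot] at hxq
        exact hx0 hxq)
    rwa [bot_sup_eq] at this
  have hdimP : ringKrullDim (R ⧸ P) ≤ ringKrullDim (R ⧸ Ideal.span {x}) :=
    ringKrullDim_le_of_surjective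
      (Ideal.Quotient.factor ((Ideal.span_singleton_le_iff_mem P).2 hx))
      (Ideal.Quotient.factor_surjective _)
  obtain ⟨e, he⟩ : ∃ e : ℕ, ringKrullDim (R ⧸ P) = e := by
    have h0 : (0 : WithBot ℕ∞) ≤ ringKrullDim (R ⧸ P) := ringKrullDim_nonneg_of_nontrivial
    have h1 := hdimP.trans hdimx
    generalize ringKrullDim (R ⧸ P) = t at h0 h1
    induction t with
    | bot => simp at h0
    | coe t =>
      induction t with
      | top =>
        exact absurd h1 (by
          rw [← WithBot.coe_natCast, WithBot.coe_le_coe, top_le_iff]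
          exact ENat.natCast_ne_top n)
      | coe t => exact ⟨t, rfl⟩
  have hen : e ≤ n := by
    have := hdimP.trans hdimx
    rw [he] at this
    exact_mod_cast this
  obtain ⟨l, l', h1, h2, h3, h4⟩ := exists_parameters n (Ideal.span {x}) P hxm hPm e hen hdimx he.le
  refine ⟨l, l', by rw [h1, he], h3, by simp [h2], ?_⟩
  rw [Ideal.ofList_cons]
  exact h4

/-- Lifts of parameters of `R ⧸ P` give a system of parameters of `R ⧸ P`. -/
theorem IsSOP.quotient {R : Type*} [CommRing R] [IsLocalRing R] (P : Ideal R)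
    [IsLocalRing (R ⧸ P)] {l : List R} (hl : (l.length : WithBot ℕ∞) = ringKrullDim (R ⧸ P))
    (hrad : (P ⊔ Ideal.ofList l).radical = maximalIdeal R) :
    IsSOP (R ⧸ P) fun i => Ideal.Quotient.mk P (l.get i) := by
  have hsurj : Function.Surjective (Ideal.Quotient.mk P) := Ideal.Quotient.mk_surjective
  have hcomap : (maximalIdeal (R ⧸ P)).comap (Ideal.Quotient.mk P) = maximalIdeal R := by
    have := Ideal.comap_isMaximal_of_surjective (Ideal.Quotient.mk P) hsurj
      (K := maximalIdeal (R ⧸ P))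
    exact eq_maximalIdeal this
  have hspan : Ideal.span (Set.range fun i => Ideal.Quotient.mk P (l.get i)) =
      (Ideal.ofList l).map (Ideal.Quotient.mk P) := by
    rw [Ideal.ofList, Ideal.map_span]
    congr 1
    ext r
    simp [List.mem_iff_get]
  refine ⟨hl, fun i => ?_, ?_⟩
  · rw [← Ideal.mem_comap, hcomap, ← hrad]
    exact Ideal.le_radical (Ideal.mem_sup_right (Ideal.subset_span (l.get_mem i)))
  · apply Ideal.comap_injective_of_surjective _ hsurj
    rw [hcomap, hspan, Ideal.comap_radical, Ideal.comap_map_of_surjective' _ hsurj,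
      Ideal.mk_ker, sup_comm, hrad]

/-- From a big Cohen-Macaulay `R`-algebra `B` whose extended ideals are closed, and a height one
prime `P`, one obtains a `B ⧸ P B`-algebra on which some parameters of `R ⧸ P` are regular. The map
is a family of Frobenius powers, and therefore not the canonical one. -/
theorem WReg.exists_quotient {R : Type u} [CommRing R] [IsDomain R] [IsLocalRing R]
    [IsNoetherianRing R] [IsAdicComplete (maximalIdeal R) R] [IsIntegrallyClosed R]
    (p : ℕ) [Fact p.Prime] [CharP R p] (P : Ideal R) [hP : P.IsPrime]
    (hht : Order.height (⟨P, hP⟩ : PrimeSpectrum R) = 1)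
    {B : Type v} [CommRing B] [Algebra R B]
    (hcl : ExtendedIdealsClosed (algebraMap R B)) {d : ℕ} {s : Fin d → R} (hs : IsSOP R s)
    (hreg : WReg (⊥ : Ideal B) ((List.ofFn s).map (algebraMap R B)))
    (hB : (maximalIdeal R).map (algebraMap R B) ≠ ⊤) :
    ∃ (l : List R) (C : Type v) (_ : CommRing C) (φ : B ⧸ P.map (algebraMap R B) →+* C),
      (l.length : WithBot ℕ∞) = ringKrullDim (R ⧸ P) ∧
      (P ⊔ Ideal.ofList l).radical = maximalIdeal R ∧
      WReg (⊥ : Ideal C)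
        (l.map (φ.comp ((Ideal.Quotient.mk _).comp (algebraMap R B)))) ∧
      Ideal.ofList (l.map (φ.comp ((Ideal.Quotient.mk _).comp (algebraMap R B)))) ≠ ⊤ := by
  obtain ⟨x, hxP, hx0, y, hyP, hxy⟩ := P.exists_dvd_mul_of_height_eq_one hht
  obtain ⟨l, l', hlen, hrad, hlen', hrad'⟩ := exists_parameters_of_mem P hxP hx0 hs.1
  set f := algebraMap R B with hf
  have hlm : ∀ z ∈ l, z ∈ maximalIdeal R := fun z hz => by
    rw [← hrad]
    exact Ideal.le_radical (Ideal.mem_sup_right (Ideal.subset_span hz))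
  have hW : WReg (Ideal.span {f x}) (l.map f) := by
    have h1 : WReg ((⊥ : Ideal R).map f) ((x :: (l ++ l')).map f) := by
      refine WReg.exchange hcl (l := List.ofFn s) (by rw [List.length_ofFn, hlen']) ?_ ?_ ?_
      · rw [bot_sup_eq, ← hs.2.2]
        exact congrArg Ideal.radical (by simpa using Ideal.ofList_map_ofFn s id)
      · rw [bot_sup_eq, hrad']
      · rwa [Ideal.map_bot]
    rw [Ideal.map_bot, List.map_cons, List.map_append, WReg.cons_iff, bot_sup_eq,
      WReg.append_iff] at h1
    exact h1.2.1
  have hPm : P ≤ maximalIdeal R := le_maximalIdeal hP.ne_top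
  have hPB : P.map f ≠ ⊤ := fun h => hB (top_le_iff.1 (h ▸ Ideal.map_mono hPm))
  have : Nontrivial (B ⧸ P.map f) := Ideal.Quotient.nontrivial_iff.2 hPB
  have : CharP (B ⧸ P.map f) p := (CharP.charP_iff_prime_eq_zero Fact.out).2 (by
    have h0 := congrArg ((Ideal.Quotient.mk (P.map f)).comp f) (CharP.cast_eq_zero R p)
    rwa [map_natCast, map_zero] at h0)
  have hkill : ∀ (I : Ideal B) (a : B), a ∈ I ⊔ P.map f → f y * a ∈ Ideal.span {f x} ⊔ I := by
    intro I a ha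
    have hle : P.map f ≤ (Ideal.span {f x}).colon ({f y} : Set B) := by
      rw [Ideal.map_le_iff_le_comap]
      intro q hq
      rw [Ideal.mem_comap, Submodule.mem_colon_singleton, smul_eq_mul, Ideal.mem_span_singleton,
        mul_comm, ← map_mul]
      exact map_dvd f (hxy q hq)
    obtain ⟨b, hb, c, hc, rfl⟩ := Submodule.mem_sup.1 ha
    rw [mul_add, add_comm]
    refine Submodule.add_mem_sup ?_ (Ideal.mul_mem_left _ _ hb)
    have := hle hc
    rwa [Submodule.mem_colon_singleton, smul_eq_mul, mul_comm] at this
  have hofList : ∀ (l : List R) (q : ℕ) (b : B),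
      Ideal.Quotient.mk (P.map f) b ∈
        Ideal.ofList (l.map fun z => ((Ideal.Quotient.mk (P.map f)).comp f) z ^ q) ↔
      b ∈ Ideal.ofList ((l.map f).map (· ^ q)) ⊔ P.map f := by
    intro l q b
    rw [← Ideal.mem_quotient_iff_mem_sup, Ideal.map_ofList, List.map_map, List.map_map]
    simp [Function.comp_def]
  obtain ⟨C, _, φ, h1, h2⟩ := WReg.exists_of_frobenius p ((Ideal.Quotient.mk (P.map f)).comp f)
    (Ideal.Quotient.mk (P.map f) (f y)) l (by
      intro e i hi b hb
      obtain ⟨b, rfl⟩ := Ideal.Quotient.mk_surjective b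
      rw [RingHom.comp_apply, ← map_pow, ← map_mul, hofList] at hb
      rw [← map_mul, hofList]
      have h3 := hkill _ _ hb
      have h4 := (WReg.iff_getElem.1 (hW.pow (p ^ e))) i (by simpa using hi) (f y * b)
      simp only [List.getElem_map, ← List.map_take] at h4
      have h5 := h4 (by convert h3 using 1; ring)
      rw [sup_comm] at h5
      refine (sup_le_sup_left ?_ _ : _ ≤ _ ⊔ P.map f) h5
      rw [Ideal.span_singleton_le_iff_mem]
      exact Ideal.mem_map_of_mem f hxP) (by
      intro M
      by_contra! hM
      have h3 : ∀ N, f (y ^ (M + 1)) ∈ (Ideal.span {x} ⊔ maximalIdeal R ^ N).map f := by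
        intro N
        have h4 := hM N
        rw [← map_pow, hofList] at h4
        have h5 := hkill _ _ h4
        rw [← map_pow, ← map_mul, ← pow_succ'] at h5
        rw [Ideal.map_sup, Ideal.map_span, Set.image_singleton]
        refine (sup_le_sup_left ?_ _ : _ ≤ Ideal.span {f x} ⊔ _) h5
        rw [Ideal.ofList, Ideal.span_le]
        intro a ha
        obtain ⟨b, hb, rfl⟩ := List.mem_map.1 ha
        obtain ⟨z, hz, rfl⟩ := List.mem_map.1 hb
        have h6 : z ^ p ^ N ∈ maximalIdeal R ^ N :=
          Ideal.pow_le_pow_right (Nat.lt_pow_self (Fact.out : p.Prime).one_lt).le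
            (Ideal.pow_mem_pow (hlm z hz) _)
        have h7 := Ideal.mem_map_of_mem f h6
        rwa [map_pow] at h7
      have h4 := hcl _ _ h3
      rw [Ideal.map_span, Set.image_singleton, Ideal.mem_span_singleton] at h4
      have h5 := WReg.dvd_of_algebraMap_dvd p hs.2.1 hs.2.2 hreg hB hx0 h4
      exact hyP (hP.mem_of_pow_mem _ (P.mem_of_dvd h5 hxP)))
  exact ⟨l, C, _, φ, hlen, hrad, h1, h2⟩

/-- **Lemma (Dietz, Lem. 8.8 / `normalcase`).** Let `(R,m)` be a complete Noetherian local
normal domain of positive prime characteristic `p`, let `P` be a height one prime of `R`,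
and set `S = R/P`. If `T` is a seed over `R`, then `T/PT` is a seed over `S`. -/
theorem seed_quotient_height_one_prime
    (R : Type u) [CommRing R] [IsDomain R] [IsLocalRing R] [IsNoetherianRing R]
    [IsAdicComplete (maximalIdeal R) R] [IsIntegrallyClosed R]
    (p : ℕ) [Fact p.Prime] [CharP R p]
    (P : Ideal R) [hP : P.IsPrime]
    (hht : Order.height (⟨P, hP⟩ : PrimeSpectrum R) = 1)
    (T : Type u) [CommRing T] [Algebra R T] (hT : IsSeed R T) :
    letI : IsLocalRing (R ⧸ P) :=
      IsLocalRing.of_surjective' (Ideal.Quotient.mk P) Ideal.Quotient.mk_surjective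
    IsSeed (R ⧸ P) (T ⧸ (P.map (algebraMap R T))) := by
  have : IsLocalRing (R ⧸ P) :=
    IsLocalRing.of_surjective' (Ideal.Quotient.mk P) Ideal.Quotient.mk_surjective
  obtain ⟨B₀, _, _, ⟨⟨d, s, hs, hsreg⟩, hB₀⟩, ⟨h⟩⟩ := hT
  have hreg₀ : WReg (⊥ : Ideal B₀) ((List.ofFn s).map (algebraMap R B₀)) :=
    WReg.bot_iff_isWeaklyRegular_algebraMap.2 hsreg.toIsWeaklyRegular
  let B := SeqMod ((maximalIdeal R).map (algebraMap R B₀))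
  let f : R →+* B := (SeqMod.diag ((maximalIdeal R).map (algebraMap R B₀))).comp (algebraMap R B₀)
  let h' : T →+* B := (SeqMod.diag ((maximalIdeal R).map (algebraMap R B₀))).comp h.toRingHom
  have hh' : ∀ r, h' (algebraMap R T r) = f r := fun r =>
    congrArg (SeqMod.diag ((maximalIdeal R).map (algebraMap R B₀))) (h.commutes r)
  let _ : Algebra R B := f.toAlgebra
  obtain ⟨l, C, _, φ, hlen, hrad, hreg, hne⟩ := WReg.exists_quotient p P hht (B := B)
    (SeqMod.extendedIdealsClosed (algebraMap R B₀)) hs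
    (SeqMod.wreg_map_maximalIdeal (algebraMap R B₀) hs.2.1 hs.2.2 hreg₀)
    (SeqMod.map_maximalIdeal_ne_top (algebraMap R B₀) hB₀)
  have hz := IsSOP.quotient P hlen hrad
  let g : R ⧸ P →+* B ⧸ P.map (algebraMap R B) :=
    Ideal.quotientMap _ (algebraMap R B) Ideal.le_comap_map
  let k : T ⧸ P.map (algebraMap R T) →+* B ⧸ P.map (algebraMap R B) :=
    Ideal.quotientMap _ h' (by
      rw [Ideal.map_le_iff_le_comap]
      intro q hq
      rw [Ideal.mem_comap, Ideal.mem_comap, hh']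
      exact Ideal.mem_map_of_mem _ hq)
  let _ : Algebra (R ⧸ P) C := (φ.comp g).toAlgebra
  have hlC : (l.map (Ideal.Quotient.mk P)).map (algebraMap (R ⧸ P) C) =
      l.map (φ.comp ((Ideal.Quotient.mk _).comp (algebraMap R B))) := by
    rw [List.map_map]; rfl
  have hofFn : (List.ofFn fun i => Ideal.Quotient.mk P (l.get i)) =
      l.map (Ideal.Quotient.mk P) := by
    conv_rhs => rw [← List.ofFn_get l, List.map_ofFn]
    rfl
  have hne' : (Ideal.ofList (List.ofFn fun i => Ideal.Quotient.mk P (l.get i))).map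
      (algebraMap (R ⧸ P) C) ≠ ⊤ := by
    rwa [hofFn, Ideal.map_ofList, hlC]
  refine ⟨C, _, _, ⟨⟨_, _, hz, ⟨?_, ?_⟩⟩, ?_⟩, ⟨⟨φ.comp k, ?_⟩⟩⟩
  · rw [← WReg.bot_iff_isWeaklyRegular_algebraMap, hofFn, hlC]
    exact hreg
  · rw [Ideal.smul_top_eq_map]
    exact fun htop => hne' (Submodule.restrictScalars_eq_top_iff (R ⧸ P) _ _ |>.1 htop.symm)
  · intro htop
    have hle : maximalIdeal (R ⧸ P) ≤
        (Ideal.ofList (List.ofFn fun i => Ideal.Quotient.mk P (l.get i))).radical := by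
      rw [← hz.2.2]
      refine Ideal.radical_mono (Ideal.span_mono ?_)
      rintro _ ⟨i, rfl⟩
      exact (List.mem_ofFn' _ _).2 ⟨i, rfl⟩
    obtain ⟨K, hK⟩ := Ideal.exists_pow_le_of_le_radical_of_fg hle (IsNoetherian.noetherian _)
    refine hne' (top_le_iff.1 (le_trans ?_ (Ideal.map_mono hK)))
    rw [Ideal.map_pow, htop, Ideal.top_pow]
  · intro r
    obtain ⟨r, rfl⟩ := Ideal.Quotient.mk_surjective r
    exact congrArg (φ ∘ Ideal.Quotient.mk _) (hh' r)
end

section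
/- Let (R,m) be a Noetherian local ring of positive prime characteristic p. If S is a minimal seed over R, then S is an integral domain. -/
open IsLocalRing

universe u v w

/-- `S` is a minimal seed over `R`: `S` is a seed and no proper homomorphic image of `S`
(i.e. no quotient by a nonzero ideal) is a seed over `R`. -/
def IsMinimalSeed (R : Type u) [CommRing R] [IsLocalRing R]
    (S : Type v) [CommRing S] [Algebra R S] : Prop :=
  IsSeed R S ∧ ∀ I : Ideal S, I ≠ ⊥ → ¬ IsSeed R (S ⧸ I)

/-- The sequence `l` is weakly regular on `B ⧸ I`, phrased elementwise in `B`. -/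
def RegularModulo {B : Type*} [CommRing B] : Ideal B → List B → Prop
  | _, [] => True
  | I, y :: l => (∀ u, y * u ∈ I → u ∈ I) ∧ RegularModulo (I ⊔ Ideal.span {y}) l

namespace RegularModulo

section Basic

variable {A B : Type*} [CommRing A] [CommRing B]

lemma mem_sup_span_singleton {I : Ideal B} {y z : B} :
    z ∈ I ⊔ Ideal.span {y} ↔ ∃ t, z - t * y ∈ I := by
  rw [sup_comm, Ideal.mem_span_singleton_sup]
  constructor
  · rintro ⟨t, b, hb, rfl⟩
    exact ⟨t, by simpa using hb⟩
  · rintro ⟨t, ht⟩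
    exact ⟨t, _, ht, by ring⟩

lemma iff_forall_getElem {I : Ideal B} {l : List B} :
    RegularModulo I l ↔ ∀ i (h : i < l.length), ∀ u,
      l[i] * u ∈ I ⊔ Ideal.ofList (l.take i) → u ∈ I ⊔ Ideal.ofList (l.take i) := by
  induction l generalizing I with
  | nil => simp [RegularModulo]
  | cons y l ih =>
    rw [RegularModulo, ih]
    constructor
    · rintro ⟨h0, h⟩ i hi u hu
      cases i with
      | zero => simpa using h0 u (by simpa using hu)
      | succ i =>
        simp only [List.take_succ_cons, Ideal.ofList_cons, ← sup_assoc,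
          List.getElem_cons_succ] at hu ⊢
        exact h i (by simpa using hi) u hu
    · intro h
      refine ⟨fun u hu => by simpa using h 0 (by simp) u (by simpa using hu), fun i hi u hu => ?_⟩
      have := h (i + 1) (by simpa using hi) u
      simp only [List.take_succ_cons, Ideal.ofList_cons, ← sup_assoc,
          List.getElem_cons_succ] at this
      exact this hu

lemma iff_isWeaklyRegular {l : List B} :
    RegularModulo ⊥ l ↔ RingTheory.Sequence.IsWeaklyRegular B l := by
  rw [iff_forall_getElem, RingTheory.Sequence.isWeaklyRegular_iff]
  simp only [isSMulRegular_quotient_iff_mem_of_smul_mem, smul_eq_mul, Ideal.mul_top, bot_sup_eq]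

/-- A nonzerodivisor followed by `s` regular modulo it stays a nonzerodivisor modulo `s`. -/
lemma mem_sup_of_mul_mem {I : Ideal B} {r s : B} (hr : ∀ u, r * u ∈ I → u ∈ I)
    (hs : ∀ u, s * u ∈ I ⊔ Ideal.span {r} → u ∈ I ⊔ Ideal.span {r}) (u : B)
    (hu : r * u ∈ I ⊔ Ideal.span {s}) : u ∈ I ⊔ Ideal.span {s} := by
  obtain ⟨v, hv⟩ := mem_sup_span_singleton.1 hu
  obtain ⟨w, hw⟩ := mem_sup_span_singleton.1 (hs v (mem_sup_span_singleton.2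
    ⟨u, by rw [← neg_mem_iff]; convert hv using 1; ring⟩))
  refine mem_sup_span_singleton.2 ⟨w, hr _ ?_⟩
  convert I.add_mem hv (I.mul_mem_left s hw) using 1
  ring

lemma mem_sup_ofList_of_mul_mem {I : Ideal B} {r : B} {l : List B}
    (h : RegularModulo I (r :: l)) (u : B) (hu : r * u ∈ I ⊔ Ideal.ofList l) :
    u ∈ I ⊔ Ideal.ofList l := by
  induction l generalizing I with
  | nil => simpa using h.1 u (by simpa using hu)
  | cons s l ih =>
    rw [Ideal.ofList_cons, ← sup_assoc] at hu ⊢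
    refine ih ⟨mem_sup_of_mul_mem h.1 h.2.1, ?_⟩ hu
    rw [sup_right_comm]
    exact h.2.2

lemma mem_of_pow_mul_mem {I : Ideal B} {r : B} (hr : ∀ u, r * u ∈ I → u ∈ I) (a : ℕ) (u : B)
    (hu : r ^ a * u ∈ I) : u ∈ I := by
  induction a generalizing u with
  | zero => simpa using hu
  | succ a ih => exact hr _ (ih _ (by rwa [pow_succ, mul_assoc] at hu))

lemma sup_span_pow {I : Ideal B} {r : B} {l : List B} (hr : ∀ u, r * u ∈ I → u ∈ I)
    (h : RegularModulo (I ⊔ Ideal.span {r}) l) (a : ℕ) :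
    RegularModulo (I ⊔ Ideal.span {r ^ a}) l := by
  induction l generalizing I with
  | nil => trivial
  | cons s l ih =>
    constructor
    · clear ih
      induction a with
      | zero => simp
      | succ a iha =>
        intro u hu
        have hle : I ⊔ Ideal.span {r ^ (a + 1)} ≤ I ⊔ Ideal.span {r ^ a} :=
          sup_le_sup_left (Ideal.span_singleton_le_span_singleton.2 (pow_dvd_pow r a.le_succ)) _
        obtain ⟨v, hv⟩ := mem_sup_span_singleton.1 (iha u (hle hu))
        obtain ⟨w, hw⟩ := mem_sup_span_singleton.1 hu
        have hsv : s * v ∈ I ⊔ Ideal.span {r} := by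
          refine mem_sup_span_singleton.2 ⟨w, mem_of_pow_mul_mem hr a _ ?_⟩
          convert I.sub_mem hw (I.mul_mem_left s hv) using 1
          ring
        obtain ⟨t, ht⟩ := mem_sup_span_singleton.1 (h.1 v hsv)
        refine mem_sup_span_singleton.2 ⟨t, ?_⟩
        convert I.add_mem hv (I.mul_mem_left (r ^ a) ht) using 1
        ring
    · rw [sup_right_comm]
      refine ih (mem_sup_of_mul_mem hr h.1) ?_
      rw [sup_right_comm]
      exact h.2

lemma map_pow {I : Ideal B} {l : List B} (h : RegularModulo I l) (a : ℕ) :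
    RegularModulo I (l.map (· ^ a)) := by
  induction l generalizing I with
  | nil => trivial
  | cons r l ih => exact ⟨mem_of_pow_mul_mem h.1 a, ih (sup_span_pow h.1 h.2 a)⟩

lemma mem_of_mul_mem_sup_ofList_pow {I : Ideal B} {r : B} {l : List B}
    (h : RegularModulo I (r :: l)) (k : ℕ) (u : B)
    (hu : r * u ∈ I ⊔ Ideal.ofList ((r :: l).map (· ^ (k + 1)))) :
    u ∈ I ⊔ Ideal.ofList ((r :: l).map (· ^ k)) := by
  have hreg : RegularModulo I (r :: l.map (· ^ (k + 1))) := ⟨h.1, h.2.map_pow _⟩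
  rw [List.map_cons, Ideal.ofList_cons, sup_left_comm, sup_comm] at hu
  obtain ⟨v, hv⟩ := mem_sup_span_singleton.1 hu
  have hmem := mem_sup_ofList_of_mul_mem hreg (u - v * r ^ k) (by convert hv using 1; ring)
  have hle : Ideal.ofList (l.map (· ^ (k + 1))) ≤ Ideal.ofList (l.map (· ^ k)) := by
    refine Ideal.span_le.2 fun z hz => ?_
    obtain ⟨y, hy, rfl⟩ := List.mem_map.1 hz
    rw [pow_succ]
    exact Ideal.mul_mem_right _ _ (Ideal.subset_span (List.mem_map_of_mem hy))
  rw [List.map_cons, Ideal.ofList_cons, sup_left_comm, sup_comm]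
  exact mem_sup_span_singleton.2 ⟨v, sup_le_sup_left hle _ hmem⟩

lemma map_of_surjective {f : A →+* B} (hf : Function.Surjective f) {I : Ideal B} {l : List A}
    (h : RegularModulo (I.comap f) l) : RegularModulo I (l.map f) := by
  induction l generalizing I with
  | nil => trivial
  | cons y l ih =>
    refine ⟨fun u hu => ?_, ih ?_⟩
    · obtain ⟨u, rfl⟩ := hf u
      exact h.1 u (by simpa using hu)
    · convert h.2 using 1
      ext z
      rw [Ideal.mem_comap, mem_sup_span_singleton, mem_sup_span_singleton, hf.exists]
      simp

lemma map_localizationAway (c : A) [Algebra A B] [IsLocalization.Away c B] {I : Ideal A}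
    {l : List A} (h : RegularModulo I l) :
    RegularModulo (I.map (algebraMap A B)) (l.map (algebraMap A B)) := by
  induction l generalizing I with
  | nil => trivial
  | cons y l ih =>
    constructor
    · intro u hu
      obtain ⟨a, s, rfl⟩ := IsLocalization.exists_mk'_eq (Submonoid.powers c) u
      rw [← IsLocalization.mk'_one (M := Submonoid.powers c) B y, ← IsLocalization.mk'_mul,
        IsLocalization.mk'_mem_map_algebraMap_iff] at hu
      obtain ⟨t, ht, hmem⟩ := hu
      rw [IsLocalization.mk'_mem_map_algebraMap_iff]
      exact ⟨t, ht, h.1 _ (by rwa [mul_left_comm])⟩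
    · have := ih h.2
      rwa [Ideal.map_sup, Ideal.map_span, Set.image_singleton] at this

end Basic

section Pi

variable {ι : Type*} {B : Type*} [CommRing B]

lemma pi_sup_span_singleton (I : ι → Ideal B) (y : ι → B) :
    Ideal.pi I ⊔ Ideal.span {y} = Ideal.pi fun i => I i ⊔ Ideal.span {y i} := by
  ext z
  simp only [mem_sup_span_singleton, Ideal.mem_pi, Classical.skolem, Pi.sub_apply, Pi.mul_apply]

lemma pi {I : ι → Ideal B} {l : List (ι → B)}
    (h : ∀ i, RegularModulo (I i) (l.map fun y => y i)) : RegularModulo (Ideal.pi I) l := by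
  induction l generalizing I with
  | nil => trivial
  | cons y l ih =>
    refine ⟨fun u hu i => (h i).1 _ (hu i), ?_⟩
    rw [pi_sup_span_singleton]
    exact ih fun i => (h i).2

end Pi

section Asymptotic

variable {B : Type*} [CommRing B]

/-- Sequences of ring elements eventually lying in each member of a family of ideals. -/
def asymptoticIdeal (I : ℕ → Ideal B) : Ideal (ℕ → B) where
  carrier := {z | ∀ k, ∀ᶠ n in Filter.atTop, z n ∈ I k}
  zero_mem' k := by simp
  add_mem' ha hb k := by
    filter_upwards [ha k, hb k] with n h1 h2 using (I k).add_mem h1 h2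
  smul_mem' c z hz k := by
    filter_upwards [hz k] with n h using (I k).mul_mem_left _ h

lemma mem_asymptoticIdeal {I : ℕ → Ideal B} {z : ℕ → B} :
    z ∈ asymptoticIdeal I ↔ ∀ k, ∀ᶠ n in Filter.atTop, z n ∈ I k := Iff.rfl

lemma asymptoticIdeal_sup_span_singleton {I : ℕ → Ideal B} (hI : Antitone I) (y : B) :
    asymptoticIdeal I ⊔ Ideal.span {fun _ => y} =
      asymptoticIdeal fun k => I k ⊔ Ideal.span {y} := by
  ext z
  rw [mem_sup_span_singleton, mem_asymptoticIdeal]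
  constructor
  · rintro ⟨t, ht⟩ k
    filter_upwards [ht k] with n hn using mem_sup_span_singleton.2 ⟨t n, hn⟩
  · intro hz
    have key : ∀ b : B, ∀ N : ℕ, ∃ t, ∀ k ≤ N,
        b ∈ I k ⊔ Ideal.span {y} → b - t * y ∈ I k := by
      intro b N
      induction N with
      | zero =>
        by_cases hb : b ∈ I 0 ⊔ Ideal.span {y}
        · obtain ⟨t, ht⟩ := mem_sup_span_singleton.1 hb
          exact ⟨t, fun k hk _ => hI hk ht⟩
        · refine ⟨0, fun k hk h => ?_⟩
          obtain rfl := Nat.le_zero.1 hk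
          exact absurd h hb
      | succ N ih =>
        by_cases hb : b ∈ I (N + 1) ⊔ Ideal.span {y}
        · obtain ⟨t, ht⟩ := mem_sup_span_singleton.1 hb
          exact ⟨t, fun k hk _ => hI hk ht⟩
        · obtain ⟨t, ht⟩ := ih
          refine ⟨t, fun k hk h => ht k ?_ h⟩
          rcases Nat.le_succ_iff.1 hk with h' | rfl
          · exact h'
          · exact absurd h hb
    choose t ht using fun n => key (z n) n
    refine ⟨t, fun k => ?_⟩
    filter_upwards [hz k, Filter.eventually_ge_atTop k] with n hn hkn using ht n k hkn hn

lemma antitone_ofList_map_pow (l : List B) :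
    Antitone fun k => Ideal.ofList (l.map (· ^ k)) := by
  intro a b hab
  refine Ideal.span_le.2 fun z hz => ?_
  obtain ⟨y, hy, rfl⟩ := List.mem_map.1 hz
  exact Ideal.mem_of_dvd _ (pow_dvd_pow y hab) (Ideal.subset_span (List.mem_map_of_mem hy))

lemma ofList_map_pow_ne_top {l : List B} (h : Ideal.ofList l ≠ ⊤) {k : ℕ} (hk : 1 ≤ k) :
    Ideal.ofList (l.map (· ^ k)) ≠ ⊤ := by
  refine ne_top_of_le_ne_top h ?_
  simpa using antitone_ofList_map_pow l hk

lemma asymptotic {K : Ideal B} {l : List B} (h : RegularModulo K l) :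
    RegularModulo (asymptoticIdeal fun k => K ⊔ Ideal.ofList (l.map (· ^ (k + 1))))
      (l.map fun y _ => y) := by
  induction l generalizing K with
  | nil => trivial
  | cons r l ih =>
    constructor
    · intro u hu k
      filter_upwards [hu (k + 1)] with n hn using mem_of_mul_mem_sup_ofList_pow h (k + 1) _ hn
    · rw [asymptoticIdeal_sup_span_singleton]
      · convert ih h.2 using 3 with k
        have hle : Ideal.span {r ^ (k + 1)} ≤ Ideal.span {r} :=
          Ideal.span_singleton_le_span_singleton.2 (dvd_pow_self r k.succ_ne_zero)
        rw [List.map_cons, Ideal.ofList_cons, sup_assoc, sup_right_comm, sup_eq_right.2 hle,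
          ← sup_assoc]
      · intro a b hab
        exact sup_le_sup_left (antitone_ofList_map_pow _ (Nat.succ_le_succ hab)) _

end Asymptotic

end RegularModulo

section Seeds

variable {R : Type u} [CommRing R] {S : Type v} [CommRing S] [Algebra R S]

/-- The image in `B` of a finite sequence of elements of `R` under `R → S → B`. -/
def sequenceImage {n : ℕ} (x : Fin n → R) {B : Type*} [CommRing B] (g : S →+* B) : List B :=
  (List.ofFn x).map fun r => g (algebraMap R S r)

lemma sequenceImage_iterateFrobenius_comp {n : ℕ} (x : Fin n → R) {B : Type*} [CommRing B]
    (f : S →+* B) (p : ℕ) [ExpChar B p] (e : ℕ) :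
    sequenceImage x ((iterateFrobenius B p e).comp f) =
      (sequenceImage x f).map (· ^ p ^ e) := by
  rw [sequenceImage, sequenceImage, List.map_map]
  rfl

variable [IsLocalRing R]

lemma IsMinimalSeed.injective (hS : IsMinimalSeed R S) {n : ℕ} {x : Fin n → R}
    (hx : IsSOP R x) {B : Type (max u v)} [CommRing B] (g : S →+* B)
    (hreg : RegularModulo ⊥ (sequenceImage x g)) (htop : Ideal.ofList (sequenceImage x g) ≠ ⊤) :
    Function.Injective g := by
  rw [RingHom.injective_iff_ker_eq_bot]
  by_contra hker
  refine hS.2 _ hker ?_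
  let : Algebra R B := (g.comp (algebraMap R S)).toAlgebra
  have hlist : sequenceImage x g = (List.ofFn x).map (algebraMap R B) := rfl
  rw [hlist] at hreg htop
  refine ⟨B, inferInstance, inferInstance, ⟨⟨n, x, hx, ?_⟩, ?_⟩, ⟨?_⟩⟩
  · refine ⟨?_, fun h => htop ?_⟩
    · rwa [← RingTheory.Sequence.isWeaklyRegular_map_algebraMap_iff B,
        ← RegularModulo.iff_isWeaklyRegular]
    · rw [← Ideal.map_ofList]
      have := Ideal.smul_top_eq_map (R := R) (S := B) (Ideal.ofList (List.ofFn x))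
      rw [← h] at this
      rw [Ideal.eq_top_iff_one]
      have h1 : (1 : B) ∈ (⊤ : Submodule R B) := trivial
      rwa [this] at h1
  · intro h
    apply htop
    rw [← Ideal.map_ofList, ← Ideal.radical_eq_top, eq_top_iff, ← h, ← hx.2.2]
    refine le_trans (Ideal.map_radical_le _) (Ideal.radical_mono (Ideal.map_mono ?_))
    refine Ideal.span_mono ?_
    rintro _ ⟨i, rfl⟩
    simp
  · exact { RingHom.kerLift g with
      commutes' := fun r => rfl }

lemma IsSeed.exists_ringHom (hS : IsSeed R S) :
    ∃ (n : ℕ) (x : Fin n → R) (B : Type (max u v)) (_ : CommRing B) (f : S →+* B),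
      IsSOP R x ∧ RegularModulo ⊥ (sequenceImage x f) ∧ Ideal.ofList (sequenceImage x f) ≠ ⊤ := by
  obtain ⟨B, _, _, ⟨⟨n, x, hx, hreg⟩, -⟩, ⟨f⟩⟩ := hS
  have hlist : sequenceImage x (f : S →+* B) = (List.ofFn x).map (algebraMap R B) := by
    simp [sequenceImage]
  refine ⟨n, x, B, inferInstance, f, hx, ?_, fun h => hreg.top_ne_smul ?_⟩
  · rw [hlist, RegularModulo.iff_isWeaklyRegular,
      RingTheory.Sequence.isWeaklyRegular_map_algebraMap_iff]
    exact hreg.toIsWeaklyRegular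
  · rw [hlist, ← Ideal.map_ofList] at h
    rw [Ideal.smul_top_eq_map, h]
    rfl

variable {n : ℕ} {x : Fin n → R} {B : Type (max u v)} [CommRing B] {f : S →+* B}

/-- An element of a minimal seed in all the ideals generated by powers of the parameters
vanishes. -/
lemma IsMinimalSeed.eq_zero_of_forall_mem_ofList_pow (hS : IsMinimalSeed R S) (hx : IsSOP R x)
    (hreg : RegularModulo ⊥ (sequenceImage x f)) (htop : Ideal.ofList (sequenceImage x f) ≠ ⊤)
    {a : S} (ha : ∀ k, f a ∈ Ideal.ofList ((sequenceImage x f).map (· ^ k))) : a = 0 := by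
  set l := sequenceImage x f with hl
  let J := RegularModulo.asymptoticIdeal fun k => ⊥ ⊔ Ideal.ofList (l.map (· ^ (k + 1)))
  let g : S →+* (ℕ → B) ⧸ J := (Ideal.Quotient.mk J).comp (RingHom.pi fun _ => f)
  have hlist : sequenceImage x g = (l.map fun y (_ : ℕ) => y).map (Ideal.Quotient.mk J) := by
    rw [hl, sequenceImage, sequenceImage, List.map_map, List.map_map]
    rfl
  refine hS.injective hx g ?_ ?_ ?_
  · rw [hlist]
    refine RegularModulo.map_of_surjective Ideal.Quotient.mk_surjective ?_
    rw [← RingHom.ker_eq_comap_bot, Ideal.mk_ker]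
    exact hreg.asymptotic
  · rw [hlist, ← Ideal.map_ofList]
    intro h
    apply htop
    have h1 : (1 : ℕ → B) ∈ Ideal.ofList (l.map fun y (_ : ℕ) => y) ⊔ J := by
      have : Ideal.Quotient.mk J 1 ∈ Ideal.map (Ideal.Quotient.mk J)
        (Ideal.ofList (l.map fun y (_ : ℕ) => y)) := by rw [h]; trivial
      rwa [← Ideal.mem_comap, Ideal.comap_map_of_surjective _ Ideal.Quotient.mk_surjective,
        ← RingHom.ker_eq_comap_bot, Ideal.mk_ker] at this
    obtain ⟨t, ht, e, he, hte⟩ := Submodule.mem_sup.1 h1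
    obtain ⟨m, hm⟩ := (he 0).exists
    rw [Ideal.eq_top_iff_one]
    have h2 := Ideal.mem_map_of_mem (Pi.evalRingHom (fun _ : ℕ => B) m) ht
    rw [Ideal.map_ofList, List.map_map] at h2
    have h3 := congrFun hte m
    rw [Pi.one_apply, Pi.add_apply] at h3
    rw [← h3]
    refine Ideal.add_mem _ ?_ ?_
    · rwa [show (Pi.evalRingHom (fun _ : ℕ => B) m) ∘ (fun (y : B) (_ : ℕ) => y) = id from rfl,
        List.map_id] at h2
    · simpa using hm
  · rw [map_zero]
    refine Ideal.Quotient.eq_zero_iff_mem.2 fun k => Filter.Eventually.of_forall fun n => ?_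
    exact Ideal.mem_sup_right (ha _)

variable (p : ℕ) [ExpChar B p]

lemma IsMinimalSeed.isReduced (hS : IsMinimalSeed R S) (hx : IsSOP R x)
    (hreg : RegularModulo ⊥ (sequenceImage x f)) (htop : Ideal.ofList (sequenceImage x f) ≠ ⊤)
    (hp : 1 < p) : IsReduced S := by
  refine ⟨fun a ⟨m, hm⟩ => ?_⟩
  refine hS.injective hx ((iterateFrobenius B p m).comp f) ?_ ?_ ?_
  · rw [sequenceImage_iterateFrobenius_comp]
    exact hreg.map_pow _
  · rw [sequenceImage_iterateFrobenius_comp]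
    exact RegularModulo.ofList_map_pow_ne_top htop (Nat.one_le_pow _ _ (by omega))
  · rw [RingHom.comp_apply, iterateFrobenius_def, ← map_pow,
      pow_eq_zero_of_le (Nat.lt_pow_self hp).le hm, map_zero, map_zero]

lemma IsMinimalSeed.eq_zero_or_eq_zero (hS : IsMinimalSeed R S) (hx : IsSOP R x)
    (hreg : RegularModulo ⊥ (sequenceImage x f)) (htop : Ideal.ofList (sequenceImage x f) ≠ ⊤)
    (hp : 1 < p) {a b : S} (hab : a * b = 0) : a = 0 ∨ b = 0 := by
  have := hS.isReduced p hx hreg htop hp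
  rw [or_iff_not_imp_left]
  intro ha
  let c : ℕ → B := fun _ => f a
  let h : S →+* (ℕ → B) := RingHom.pi fun e => (iterateFrobenius B p e).comp f
  let g : S →+* Localization.Away c := (algebraMap (ℕ → B) _).comp h
  have hlist : sequenceImage x g = (sequenceImage x h).map (algebraMap _ _) := by
    rw [sequenceImage, sequenceImage, List.map_map]
    rfl
  have heval (e : ℕ) : (sequenceImage x h).map (fun y => y e) =
      (sequenceImage x f).map (· ^ p ^ e) := by
    rw [sequenceImage, sequenceImage, List.map_map, List.map_map]
    rfl
  refine hS.injective hx g ?_ ?_ ?_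
  · rw [hlist, ← Ideal.map_bot (f := algebraMap (ℕ → B) (Localization.Away c))]
    refine RegularModulo.map_localizationAway c ?_
    have hbot : (⊥ : Ideal (ℕ → B)) = Ideal.pi fun _ => ⊥ := by
      ext z
      simp [Ideal.mem_pi, funext_iff]
    rw [hbot]
    refine RegularModulo.pi fun e => ?_
    rw [heval]
    exact hreg.map_pow _
  · rw [hlist, ← Ideal.map_ofList,
      IsLocalization.map_algebraMap_ne_top_iff_disjoint (Submonoid.powers c), Set.disjoint_left]
    rintro _ ⟨m, rfl⟩ hmem
    apply ha
    refine eq_zero_of_pow_eq_zero (n := m) ?_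
    refine hS.eq_zero_of_forall_mem_ofList_pow hx hreg htop fun k => ?_
    have h2 := Ideal.mem_map_of_mem (Pi.evalRingHom (fun _ : ℕ => B) k) hmem
    rw [Ideal.map_ofList] at h2
    have h3 : f (a ^ m) ∈ Ideal.ofList ((sequenceImage x h).map (fun y => y k)) := by
      rw [map_pow]
      exact h2
    rw [heval] at h3
    exact RegularModulo.antitone_ofList_map_pow _ (Nat.lt_pow_self hp).le h3
  · rw [map_zero, RingHom.comp_apply, IsLocalization.map_eq_zero_iff (Submonoid.powers c)]
    refine ⟨⟨c, Submonoid.mem_powers c⟩, funext fun e => ?_⟩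
    change f a * iterateFrobenius B p e (f b) = 0
    obtain ⟨m, hm⟩ := Nat.exists_eq_succ_of_ne_zero (pow_pos (by omega : 0 < p) e).ne'
    rw [iterateFrobenius_def, hm, pow_succ', ← mul_assoc, ← map_mul, hab, map_zero, zero_mul]

end Seeds

/-- **Proposition (Dietz, Prop. 7.2 / `mindom`).** Let `(R,m)` be a Noetherian local ring
of positive prime characteristic `p`. If `S` is a minimal seed over `R`, then `S` is an
integral domain. -/
theorem minimal_seed_isDomain
    (R : Type u) [CommRing R] [IsLocalRing R] [IsNoetherianRing R]
    (p : ℕ) [Fact p.Prime] [CharP R p]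
    (S : Type v) [CommRing S] [Algebra R S]
    (hS : IsMinimalSeed R S) : IsDomain S := by
  obtain ⟨n, x, B, _, f, hx, hreg, htop⟩ := hS.1.exists_ringHom
  have hB : Nontrivial B := by
    by_contra h
    rw [not_nontrivial_iff_subsingleton] at h
    exact htop (Subsingleton.elim _ _)
  have hp : p.Prime := Fact.out
  have hpB : (p : B) = 0 := by
    rw [← map_natCast (f.comp (algebraMap R S)), CharP.cast_eq_zero, map_zero]
  have : CharP B p := (CharP.charP_iff_prime_eq_zero hp).2 hpB
  have : Nontrivial S := f.domain_nontrivial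
  have : NoZeroDivisors S :=
    ⟨fun hab => hS.eq_zero_or_eq_zero p hx hreg htop hp.one_lt hab⟩
  exact NoZeroDivisors.to_isDomain S
end

section
/- Let (R,m) be a Noetherian local ring and let S be a seed over R. Then there exists an ideal I of S such that S/I is a minimal seed over R. -/
open IsLocalRing

universe u v w

/-- `u` is a nonzerodivisor modulo the ideal `I`. -/
def NonzerodivisorMod {A : Type*} [CommRing A] (u : A) (I : Ideal A) : Prop :=
  ∀ b, u * b ∈ I → b ∈ I

namespace NonzerodivisorMod

variable {A : Type*} [CommRing A] {I : Ideal A} {u u' v : A}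

lemma sup_swap (hu : NonzerodivisorMod u I) (hv : NonzerodivisorMod v (I ⊔ Ideal.span {u})) :
    NonzerodivisorMod u (I ⊔ Ideal.span {v}) := by
  intro b hb
  obtain ⟨i, hi, w, hw, h⟩ := Submodule.mem_sup.1 hb
  obtain ⟨c, rfl⟩ := Ideal.mem_span_singleton'.1 hw
  have hc : c ∈ I ⊔ Ideal.span {u} := by
    refine hv c (Submodule.mem_sup.2 ⟨-i, I.neg_mem hi, u * b, ?_, by linear_combination -h⟩)
    exact Ideal.mul_mem_right _ _ (Ideal.mem_span_singleton_self u)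
  obtain ⟨i', hi', w', hw', rfl⟩ := Submodule.mem_sup.1 hc
  obtain ⟨e, rfl⟩ := Ideal.mem_span_singleton'.1 hw'
  have hbe : b - e * v ∈ I := by
    refine hu _ ?_
    have : u * (b - e * v) = i + v * i' := by linear_combination -h
    rw [this]
    exact I.add_mem hi (I.mul_mem_left _ hi')
  exact Submodule.mem_sup.2 ⟨_, hbe, e * v, Ideal.mul_mem_left _ _
    (Ideal.mem_span_singleton_self v), by ring⟩

lemma sup_mul (hu : NonzerodivisorMod u I) (h : NonzerodivisorMod v (I ⊔ Ideal.span {u}))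
    (h' : NonzerodivisorMod v (I ⊔ Ideal.span {u'})) :
    NonzerodivisorMod v (I ⊔ Ideal.span {u * u'}) := by
  intro b hb
  obtain ⟨i, hi, w, hw, hiw⟩ := Submodule.mem_sup.1 hb
  obtain ⟨e, rfl⟩ := Ideal.mem_span_singleton'.1 hw
  have hbu : b ∈ I ⊔ Ideal.span {u} := by
    refine h b (Submodule.mem_sup.2 ⟨i, hi, u * (e * u'), ?_, by linear_combination hiw⟩)
    exact Ideal.mul_mem_right _ _ (Ideal.mem_span_singleton_self u)
  obtain ⟨j, hj, w', hw', rfl⟩ := Submodule.mem_sup.1 hbu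
  obtain ⟨c, rfl⟩ := Ideal.mem_span_singleton'.1 hw'
  have hvc : v * c - e * u' ∈ I := by
    refine hu _ ?_
    have : u * (v * c - e * u') = i - v * j := by linear_combination -hiw
    rw [this]
    exact I.sub_mem hi (I.mul_mem_left _ hj)
  have hc : c ∈ I ⊔ Ideal.span {u'} := by
    refine h' c (Submodule.mem_sup.2 ⟨_, hvc, e * u', ?_, by ring⟩)
    exact Ideal.mul_mem_left _ _ (Ideal.mem_span_singleton_self u')
  obtain ⟨k, hk, w'', hw'', rfl⟩ := Submodule.mem_sup.1 hc
  obtain ⟨f, rfl⟩ := Ideal.mem_span_singleton'.1 hw''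
  refine Submodule.mem_sup.2 ⟨j + k * u, I.add_mem hj (I.mul_mem_right _ hk), f * (u * u'), ?_,
    by ring⟩
  exact Ideal.mul_mem_left _ _ (Ideal.mem_span_singleton_self _)

lemma mul (hu : NonzerodivisorMod u I) (hu' : NonzerodivisorMod u' I) :
    NonzerodivisorMod (u * u') I :=
  fun b hb ↦ hu' b (hu _ (by rwa [← mul_assoc]))

lemma of_pow_mem {N : ℕ} (hu : NonzerodivisorMod u I) (h : u ^ N ∈ I ⊔ Ideal.span {v}) :
    NonzerodivisorMod v I := by
  intro b hb
  have hpow : ∀ k, NonzerodivisorMod (u ^ k) I := by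
    intro k
    induction k with
    | zero => intro b hb; simpa using hb
    | succ k ih => rw [pow_succ]; exact ih.mul hu
  refine hpow N b ?_
  obtain ⟨i, hi, w, hw, h⟩ := Submodule.mem_sup.1 h
  obtain ⟨e, rfl⟩ := Ideal.mem_span_singleton'.1 hw
  have : u ^ N * b = i * b + e * (v * b) := by linear_combination -b * h
  rw [this]
  exact I.add_mem (I.mul_mem_right _ hi) (I.mul_mem_left _ hb)

end NonzerodivisorMod

/-- The elements `x i`, for `i` running through the list `l`, form a weakly regular sequence
modulo the ideal `I`. -/
def RegularMod {A ι : Type*} [CommRing A] (x : ι → A) : Ideal A → List ι → Prop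
  | _, [] => True
  | I, i :: l => NonzerodivisorMod (x i) I ∧ RegularMod x (I ⊔ Ideal.span {x i}) l

namespace RegularMod

variable {A ι : Type*} [CommRing A] {x y : ι → A} {I : Ideal A} {l : List ι}

lemma of_forall_append (h : ∀ l₁ i l₂, l = l₁ ++ i :: l₂ →
    NonzerodivisorMod (x i) (I ⊔ Ideal.span (x '' {j | j ∈ l₁}))) : RegularMod x I l := by
  induction l generalizing I with
  | nil => trivial
  | cons i l ih =>
    refine ⟨by simpa using h [] i l rfl, ih fun l₁ j l₂ hl ↦ ?_⟩
    have := h (i :: l₁) j l₂ (by simp [hl])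
    have hs : {k | k ∈ i :: l₁} = insert i {k | k ∈ l₁} := by ext; simp
    rwa [hs, Set.image_insert_eq, Ideal.span_insert, ← sup_assoc] at this

lemma top (x : ι → A) (l : List ι) : RegularMod x ⊤ l := by
  induction l with
  | nil => trivial
  | cons i l ih => exact ⟨fun _ _ ↦ trivial, by simpa using ih⟩

lemma sup_mul {u u' : A} (hu : NonzerodivisorMod u I) (h : RegularMod x (I ⊔ Ideal.span {u}) l)
    (h' : RegularMod x (I ⊔ Ideal.span {u'}) l) :
    RegularMod x (I ⊔ Ideal.span {u * u'}) l := by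
  induction l generalizing I with
  | nil => trivial
  | cons i l ih =>
    refine ⟨hu.sup_mul h.1 h'.1, ?_⟩
    rw [sup_right_comm]
    refine ih (hu.sup_swap h.1) ?_ ?_
    · rw [sup_right_comm]; exact h.2
    · rw [sup_right_comm]; exact h'.2

lemma sup_pow {u : A} (hu : NonzerodivisorMod u I) (h : RegularMod x (I ⊔ Ideal.span {u}) l)
    (k : ℕ) : NonzerodivisorMod (u ^ k) I ∧ RegularMod x (I ⊔ Ideal.span {u ^ k}) l := by
  induction k with
  | zero =>
    refine ⟨fun b hb ↦ by simpa using hb, ?_⟩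
    simpa using top x l
  | succ k ih =>
    rw [pow_succ]
    exact ⟨ih.1.mul hu, sup_mul ih.1 ih.2 h⟩

lemma pow (h : RegularMod x I l) (a : ι → ℕ) : RegularMod (fun i ↦ x i ^ a i) I l := by
  induction l generalizing I with
  | nil => trivial
  | cons i l ih =>
    have hp := sup_pow (x := fun i ↦ x i ^ a i) h.1 (ih h.2) (a i)
    exact ⟨hp.1, hp.2⟩

lemma nonzerodivisorMod_sup_tail {u : A} (hu : NonzerodivisorMod u I)
    (h : RegularMod x (I ⊔ Ideal.span {u}) l) :
    NonzerodivisorMod u (I ⊔ Ideal.span (x '' {j | j ∈ l})) := by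
  induction l generalizing I with
  | nil => simpa using hu
  | cons i l ih =>
    have hs : {k | k ∈ i :: l} = insert i {k | k ∈ l} := by ext; simp
    rw [hs, Set.image_insert_eq, Ideal.span_insert, ← sup_assoc]
    refine ih (hu.sup_swap h.1) ?_
    rw [sup_right_comm]; exact h.2

lemma nonzerodivisorMod_sup_ne (h : RegularMod x I l) (hl : l.Nodup) {i : ι} (hi : i ∈ l) :
    NonzerodivisorMod (x i) (I ⊔ Ideal.span (x '' {j | j ∈ l ∧ j ≠ i})) := by
  induction l generalizing I with
  | nil => simp at hi
  | cons k l ih =>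
    rw [List.nodup_cons] at hl
    rcases List.mem_cons.1 hi with rfl | hil
    · have hs : {j | j ∈ i :: l ∧ j ≠ i} = {j | j ∈ l} := by
        ext j; simp only [List.mem_cons, Set.mem_ofPred_eq]
        constructor
        · tauto
        · intro hj; exact ⟨.inr hj, fun h ↦ hl.1 (h ▸ hj)⟩
      rw [hs]
      exact nonzerodivisorMod_sup_tail h.1 h.2
    · have hs : {j | j ∈ k :: l ∧ j ≠ i} = insert k {j | j ∈ l ∧ j ≠ i} := by
        ext j; simp only [List.mem_cons, Set.mem_ofPred_eq, Set.mem_insert_iff]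
        constructor
        · tauto
        · rintro (rfl | hj)
          · exact ⟨.inl rfl, fun h ↦ hl.1 (h ▸ hil)⟩
          · tauto
      rw [hs, Set.image_insert_eq, Ideal.span_insert, ← sup_assoc]
      exact ih h.2 hl.2 hil

end RegularMod

/-- Each `x j` is a nonzerodivisor modulo the ideal generated by any set of powers of all the other
elements of the family `x`. -/
def PowRegular {A ι : Type*} [CommRing A] (x : ι → A) : Prop :=
  ∀ (a : ι → ℕ) (j : ι), NonzerodivisorMod (x j) (Ideal.span ((fun i ↦ x i ^ a i) '' {i | i ≠ j}))

/-- The family `x` is weakly regular in any order. -/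
def PermRegular {A ι : Type*} [CommRing A] (x : ι → A) : Prop :=
  ∀ (F : Set ι), ∀ j ∉ F, NonzerodivisorMod (x j) (Ideal.span (x '' F))

lemma RegularMod.powRegular {A ι : Type*} [CommRing A] [DecidableEq ι] {x : ι → A} {l : List ι}
    (h : RegularMod x ⊥ l) (hl : l.Nodup) (hmem : ∀ i, i ∈ l) : PowRegular x := by
  intro a j
  have := (h.pow (Function.update a j 1)).nonzerodivisorMod_sup_ne hl (hmem j)
  simp only [Function.update_self, pow_one, bot_sup_eq, hmem, true_and] at this
  convert this using 2
  refine Set.image_congr fun i hi ↦ ?_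
  rw [Function.update_of_ne hi]

lemma PowRegular.mem_of_mul_mem {A ι : Type*} [CommRing A] {x : ι → A} (hx : PowRegular x)
    {F : Set ι} {j : ι} (hj : j ∉ F) {m : ℕ} {b : A}
    (hb : x j * b ∈ Ideal.span (x '' F) ⊔ Ideal.span (Set.range fun i ↦ x i ^ (m + 1))) :
    b ∈ Ideal.span (x '' F) ⊔ Ideal.span (Set.range fun i ↦ x i ^ m) := by
  classical
  let a : ι → ℕ := fun i ↦ if i ∈ F then 1 else m + 1
  set J := Ideal.span ((fun i ↦ x i ^ a i) '' {i | i ≠ j}) with hJ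
  have hle : Ideal.span (x '' F) ⊔ Ideal.span (Set.range fun i ↦ x i ^ (m + 1)) ≤
      J ⊔ Ideal.span {x j ^ (m + 1)} := by
    have hF : ∀ i ∈ F, x i ∈ J := fun i hi ↦
      Ideal.subset_span ⟨i, fun h ↦ hj (h ▸ hi), by simp [a, hi]⟩
    refine sup_le ?_ ?_
    · rw [Ideal.span_le]
      rintro _ ⟨i, hi, rfl⟩
      exact Ideal.mem_sup_left (hF i hi)
    · rw [Ideal.span_le]
      rintro _ ⟨i, rfl⟩
      by_cases hij : i = j
      · subst hij; exact Ideal.mem_sup_right (Ideal.mem_span_singleton_self _)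
      · refine Ideal.mem_sup_left ?_
        by_cases hi : i ∈ F
        · exact Ideal.pow_mem_of_mem _ (hF i hi) _ m.succ_pos
        · exact Ideal.subset_span ⟨i, hij, by simp [a, hi]⟩
  have hm : ∀ i, x i ^ m ∈ Ideal.span (Set.range fun i ↦ x i ^ m) :=
    fun i ↦ Ideal.subset_span ⟨i, rfl⟩
  have hge : J ≤ Ideal.span (x '' F) ⊔ Ideal.span (Set.range fun i ↦ x i ^ m) := by
    rw [hJ, Ideal.span_le]
    rintro _ ⟨i, -, rfl⟩
    by_cases hi : i ∈ F
    · simpa [a, hi] using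
        Ideal.mem_sup_left (Ideal.subset_span (Set.mem_image_of_mem x hi))
    · simp only [a, hi, if_false, pow_succ]
      exact Ideal.mem_sup_right (Ideal.mul_mem_right _ _ (hm i))
  obtain ⟨c, hc, w, hw, h⟩ := Submodule.mem_sup.1 (hle hb)
  obtain ⟨e, rfl⟩ := Ideal.mem_span_singleton'.1 hw
  have hbe : b - e * x j ^ m ∈ J := by
    refine hx a j _ ?_
    convert hc using 1
    linear_combination -h
  rw [← sub_add_cancel b (e * x j ^ m)]
  exact Ideal.add_mem _ (hge hbe) (Ideal.mem_sup_right (Ideal.mul_mem_left _ _ (hm j)))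

lemma PermRegular.powRegular {A ι : Type*} [CommRing A] [Finite ι] {x : ι → A}
    (hx : PermRegular x) : PowRegular x := by
  classical
  have := Fintype.ofFinite ι
  refine RegularMod.powRegular (l := Finset.univ.toList) (.of_forall_append ?_)
    (Finset.nodup_toList _) (by simp)
  intro l₁ i l₂ hl
  rw [bot_sup_eq]
  have := hl ▸ Finset.nodup_toList (Finset.univ : Finset ι)
  refine hx _ i ?_
  simp only [Set.mem_ofPred_eq]
  grind

/-- If `x` is regular in any order, then replacing `x i` by an element `z` such that some power of
`x i` lies in the ideal generated by `z` and the remaining `x j` gives a regular family. -/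
lemma PermRegular.powRegular_update {A ι : Type*} [CommRing A] [Finite ι] [DecidableEq ι]
    {x : ι → A} (hx : PermRegular x) {i : ι} {z : A} {N : ℕ}
    (h : x i ^ N ∈ Ideal.span (x '' {i}ᶜ) ⊔ Ideal.span {z}) :
    PowRegular (Function.update x i z) := by
  have := Fintype.ofFinite ι
  have hnd := Finset.nodup_toList (Finset.univ.erase i : Finset ι)
  refine RegularMod.powRegular (l := (Finset.univ.erase i).toList ++ [i]) (.of_forall_append ?_)
    (by rw [List.nodup_append]; simp [hnd]) (by intro j; by_cases j = i <;> simp [*])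
  intro l₁ j l₂ hl
  rw [bot_sup_eq]
  have himg (hi : i ∉ l₁) : Function.update x i z '' {j | j ∈ l₁} = x '' {j | j ∈ l₁} :=
    Set.image_congr fun k hk ↦ Function.update_of_ne (fun h ↦ hi (by rwa [h] at hk)) _ _
  rcases List.eq_nil_or_concat l₂ with rfl | ⟨l, k, rfl⟩
  · obtain ⟨rfl, h'⟩ := List.append_inj' hl rfl
    obtain rfl : i = j := by simpa using h'
    rw [himg (by simp), Function.update_self]
    have : {j | j ∈ (Finset.univ.erase i).toList} = ({i}ᶜ : Set ι) := by ext; simp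
    rw [this]
    exact (hx _ i (by simp)).of_pow_mem h
  · obtain ⟨hl', -⟩ := List.append_inj' (t₁ := [i]) (s₂ := l₁ ++ j :: l) (t₂ := [k])
      (s₁ := (Finset.univ.erase i).toList) (by simpa using hl) rfl
    have hi : i ∉ l₁ ++ j :: l := hl' ▸ by simp
    rw [hl'] at hnd
    simp only [List.mem_append, List.mem_cons, not_or] at hi
    rw [himg hi.1, Function.update_of_ne (Ne.symm hi.2.1)]
    refine hx _ j ?_
    simp only [Set.mem_ofPred_eq]
    grind

section LimitProduct

variable {R ι α : Type*} [CommRing R] (f : Filter α) (B : α → Type*) [∀ a, CommRing (B a)]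
  [∀ a, Algebra R (B a)] (x : ι → R)

/-- The ideal of those elements of `∀ a, B a` that tend to zero along `f` with respect to the
topologies defined by the ideals generated by powers of the `x i`. -/
def nullIdeal : Ideal (∀ a, B a) where
  carrier := {b | ∀ m : ℕ, ∀ᶠ a in f,
    b a ∈ Ideal.span (Set.range fun i ↦ algebraMap R (B a) (x i) ^ m)}
  add_mem' hb hc m := by
    filter_upwards [hb m, hc m] with a hb hc using Ideal.add_mem _ hb hc
  zero_mem' m := by simp
  smul_mem' c b hb m := by
    filter_upwards [hb m] with a hb using Ideal.mul_mem_left _ _ hb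

/-- The product of the algebras `B a` modulo the ideal of elements tending to zero along `f`. -/
abbrev LimitProduct := (∀ a, B a) ⧸ nullIdeal f B x

variable {f B x}

lemma mem_nullIdeal {b : ∀ a, B a} : b ∈ nullIdeal f B x ↔
    ∀ m : ℕ, ∀ᶠ a in f, b a ∈ Ideal.span (Set.range fun i ↦ algebraMap R (B a) (x i) ^ m) :=
  Iff.rfl

lemma mem_of_mem_span_pi {F : Set ι} {b : ∀ a, B a}
    (hb : b ∈ Ideal.span ((fun i ↦ algebraMap R (∀ a, B a) (x i)) '' F)) (a : α) :
    b a ∈ Ideal.span ((fun i ↦ algebraMap R (B a) (x i)) '' F) := by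
  have := Ideal.mem_map_of_mem (Pi.evalRingHom B a) hb
  rw [Ideal.map_span, Set.image_image] at this
  exact this

lemma mem_span_image_iff_exists {A : Type*} [CommRing A] [Fintype ι] {y : ι → A} {F : Set ι}
    {b : A} [DecidablePred (· ∈ F)] :
    b ∈ Ideal.span (y '' F) ↔ ∃ c : ι → A, ∑ i, c i * (if i ∈ F then y i else 0) = b := by
  rw [← Ideal.mem_span_range_iff_exists_fun]
  suffices Ideal.span (y '' F) = Ideal.span (Set.range fun i ↦ if i ∈ F then y i else 0) by
    rw [this]
  apply le_antisymm <;> rw [Ideal.span_le]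
  · rintro _ ⟨i, hi, rfl⟩
    exact Ideal.subset_span ⟨i, by simp [hi]⟩
  · rintro _ ⟨i, rfl⟩
    by_cases hi : i ∈ F
    · simpa [hi] using Ideal.subset_span (Set.mem_image_of_mem y hi)
    · simp [hi]

lemma mem_span_pi_of_forall_mem [Finite ι] {F : Set ι} {b : ∀ a, B a}
    (hb : ∀ a, b a ∈ Ideal.span ((fun i ↦ algebraMap R (B a) (x i)) '' F)) :
    b ∈ Ideal.span ((fun i ↦ algebraMap R (∀ a, B a) (x i)) '' F) := by
  classical
  have := Fintype.ofFinite ι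
  simp only [mem_span_image_iff_exists] at hb ⊢
  choose c hc using hb
  refine ⟨fun i a ↦ c a i, funext fun a ↦ ?_⟩
  rw [← hc a, Finset.sum_apply]
  refine Finset.sum_congr rfl fun i _ ↦ ?_
  by_cases hi : i ∈ F <;> simp [hi]

lemma LimitProduct.permRegular [Finite ι] {g : α → ℕ} (hg : Filter.Tendsto g f Filter.atTop)
    (hB : ∀ a, PowRegular fun i ↦ algebraMap R (B a) (x i)) :
    PermRegular fun i ↦ algebraMap R (LimitProduct f B x) (x i) := by
  classical
  intro F j hj b hb
  obtain ⟨b, rfl⟩ := Ideal.Quotient.mk_surjective b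
  have himg : (fun i ↦ algebraMap R (LimitProduct f B x) (x i)) '' F =
      Ideal.Quotient.mk (nullIdeal f B x) '' ((fun i ↦ algebraMap R (∀ a, B a) (x i)) '' F) := by
    rw [Set.image_image]; rfl
  rw [himg, ← Ideal.map_span] at hb ⊢
  have hb' : Ideal.Quotient.mk (nullIdeal f B x) (algebraMap R _ (x j) * b) ∈ Ideal.map
      (Ideal.Quotient.mk (nullIdeal f B x))
      (Ideal.span ((fun i ↦ algebraMap R (∀ a, B a) (x i)) '' F)) := hb
  rw [Ideal.mem_quotient_iff_mem_sup] at hb' ⊢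
  obtain ⟨k, hk, e, he, hke⟩ := Submodule.mem_sup.1 hb'
  let P (a : α) (m : ℕ) : Prop := b a ∈ Ideal.span ((fun i ↦ algebraMap R (B a) (x i)) '' F) ⊔
    Ideal.span (Set.range fun i ↦ algebraMap R (B a) (x i) ^ m)
  have hP (m : ℕ) : ∀ᶠ a in f, P a m := by
    filter_upwards [mem_nullIdeal.1 he (m + 1)] with a ha
    refine (hB a).mem_of_mul_mem hj ?_
    have : algebraMap R (B a) (x j) * b a = k a + e a := (congrFun hke a).symm
    rw [this]
    exact Submodule.add_mem_sup (mem_of_mem_span_pi hk a) ha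
  have hP0 (a : α) : P a (Nat.findGreatest (P a) (g a)) := by
    refine Nat.findGreatest_spec (P := P a) (Nat.zero_le _)
      (Ideal.mem_sup_right ?_)
    have h1 : (1 : B a) ∈ Ideal.span (Set.range fun i ↦ algebraMap R (B a) (x i) ^ 0) :=
      Ideal.subset_span ⟨j, pow_zero _⟩
    simpa using Ideal.mul_mem_left _ (b a) h1
  choose k' hk' e' he' hke' using fun a ↦ Submodule.mem_sup.1 (hP0 a)
  refine Submodule.mem_sup.2 ⟨k', mem_span_pi_of_forall_mem hk', e', mem_nullIdeal.2 fun m ↦ ?_,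
    funext hke'⟩
  filter_upwards [hP m, hg.eventually_ge_atTop m] with a ha hga
  refine Ideal.span_le.2 ?_ (he' a)
  rintro _ ⟨i, rfl⟩
  exact Ideal.mem_of_dvd _ (pow_dvd_pow _ (Nat.le_findGreatest hga ha))
    (Ideal.subset_span ⟨i, rfl⟩)

lemma LimitProduct.map_ne_top [f.NeBot] {I : Ideal R} (hx : ∀ i, x i ∈ I)
    (hB : ∀ a, I.map (algebraMap R (B a)) ≠ ⊤) :
    I.map (algebraMap R (LimitProduct f B x)) ≠ ⊤ := by
  intro h
  rw [Ideal.eq_top_iff_one] at h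
  have h' : Ideal.Quotient.mk (nullIdeal f B x) 1 ∈
      (I.map (algebraMap R (∀ a, B a))).map (Ideal.Quotient.mk (nullIdeal f B x)) := by
    rw [Ideal.map_map]; exact h
  rw [Ideal.mem_quotient_iff_mem_sup] at h'
  obtain ⟨k, hk, e, he, hke⟩ := Submodule.mem_sup.1 h'
  obtain ⟨a, ha⟩ := (mem_nullIdeal.1 he 1).exists
  refine hB a ((Ideal.eq_top_iff_one _).2 ?_)
  rw [show (1 : B a) = k a + e a from (congrFun hke a).symm]
  refine Ideal.add_mem _ ?_ (Ideal.span_le.2 ?_ ha)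
  · have := Ideal.mem_map_of_mem (Pi.evalRingHom B a) hk
    rwa [Ideal.map_map] at this
  · rintro _ ⟨i, rfl⟩
    simpa using Ideal.mem_map_of_mem _ (hx i)

end LimitProduct

lemma Ideal.span_image_compl_sup_span {R ι : Type*} [CommRing R] (x : ι → R) (i : ι) :
    Ideal.span (x '' {i}ᶜ) ⊔ Ideal.span {x i} = Ideal.span (Set.range x) := by
  rw [← Ideal.span_union, ← Set.image_singleton, ← Set.image_union, Set.compl_union_self,
    Set.image_univ]

namespace IsSOP

variable {R : Type*} [CommRing R] [IsLocalRing R] {n : ℕ} {x : Fin n → R}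

lemma span_image_compl_le (hx : IsSOP R x) (i : Fin n) :
    Ideal.span (x '' {i}ᶜ) ≤ maximalIdeal R := by
  rw [Ideal.span_le]
  rintro _ ⟨j, -, rfl⟩
  exact hx.2.1 j

variable [IsNoetherianRing R]

lemma maximalIdeal_notMem_minimalPrimes (hx : IsSOP R x) (i : Fin n) :
    maximalIdeal R ∉ (Ideal.span (x '' {i}ᶜ)).minimalPrimes := by
  intro h
  have h1 := Ideal.height_le_card_of_mem_minimalPrimes_span (Set.toFinite _) h
  have h2 : (x '' {i}ᶜ).ncard ≤ n - 1 := by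
    refine (Set.ncard_image_le (Set.toFinite _)).trans ?_
    rw [Set.ncard_compl]
    simp
  have h3 := hx.1
  rw [← maximalIdeal_height_eq_ringKrullDim] at h3
  have h4 : (n : ℕ∞) = (maximalIdeal R).height := by exact_mod_cast h3
  rw [← h4] at h1
  have h5 : n ≤ (x '' {i}ᶜ).ncard := by exact_mod_cast h1
  have := i.pos
  omega

lemma update (hx : IsSOP R x) {i : Fin n} {z : R} (hz : z ∈ maximalIdeal R)
    (hz' : ∀ p ∈ (Ideal.span (x '' {i}ᶜ)).minimalPrimes, z ∉ p) :
    IsSOP R (Function.update x i z) := by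
  have hmem : ∀ j, Function.update x i z j ∈ maximalIdeal R := by
    intro j
    by_cases h : j = i
    · subst h; simpa using hz
    · simpa [h] using hx.2.1 j
  have hle : Ideal.span (Set.range (Function.update x i z)) ≤ maximalIdeal R := by
    rw [Ideal.span_le]
    rintro _ ⟨j, rfl⟩
    exact hmem j
  refine ⟨hx.1, hmem, le_antisymm ?_ ?_⟩
  · exact (maximalIdeal.isMaximal R).isPrime.radical_le_iff.2 hle
  · set I := Ideal.span (x '' {i}ᶜ) with hI
    have himg : Function.update x i z '' {i}ᶜ = x '' {i}ᶜ :=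
      Set.image_congr fun j hj ↦ Function.update_of_ne hj _ _
    rw [Ideal.radical_eq_sInf]
    refine le_sInf fun P ⟨hP, hPp⟩ ↦ ?_
    rw [← Ideal.span_image_compl_sup_span _ i, himg, Function.update_self, ← hI, sup_le_iff,
      Ideal.span_singleton_le_iff_mem] at hP
    obtain ⟨p, hp, hpP⟩ := Ideal.exists_minimalPrimes_le hP.1
    have hlt : p < P := lt_of_le_of_ne hpP fun h ↦ hz' p hp (h ▸ hP.2)
    by_contra hmP
    have hPm : P < maximalIdeal R :=
      lt_of_le_of_ne (le_maximalIdeal hPp.ne_top) fun h ↦ hmP h.ge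
    have hmin : maximalIdeal R ∈ (I ⊔ Ideal.span {x i}).minimalPrimes := by
      rw [hI, Ideal.span_image_compl_sup_span, ← Ideal.radical_minimalPrimes, hx.2.2,
        Ideal.minimalPrimes_eq_subsingleton_self]
      rfl
    have hstrict {q q' : Ideal R} (hI : I ≤ q) (h : q < q') :
        q.map (Ideal.Quotient.mk I) < q'.map (Ideal.Quotient.mk I) := by
      refine lt_of_le_not_ge (Ideal.map_mono h.le) fun h' ↦ h.not_ge ?_
      rwa [Ideal.map_le_iff_le_comap, Ideal.comap_map_mk hI] at h'
    have := hp.isPrime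
    have := Ideal.isPrime_map_quotientMk_of_isPrime hp.le
    have := Ideal.isPrime_map_quotientMk_of_isPrime hP.1
    have := Ideal.isPrime_map_quotientMk_of_isPrime (hx.span_image_compl_le i)
    have h1 := Ideal.map_height_le_one_of_mem_minimalPrimes hmin
    have h2 := Ideal.height_add_one_le_of_lt_of_isPrime (hstrict hp.le hlt)
    have h3 := Ideal.height_add_one_le_of_lt_of_isPrime (hstrict hP.1 hPm)
    have h4 : (2 : ℕ∞) ≤ 1 := calc
      (2 : ℕ∞) = 0 + 1 + 1 := by norm_num
      _ ≤ _ := (add_le_add_left ((add_le_add_left zero_le 1).trans h2) 1).trans (h3.trans h1)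
    exact absurd h4 (by decide)

lemma exists_update_update {y : Fin n → R} (hx : IsSOP R x) (hy : IsSOP R y) (i : Fin n) :
    ∃ z, IsSOP R (Function.update x i z) ∧ IsSOP R (Function.update y i z) := by
  let s : Set (Ideal R) :=
    (Ideal.span (x '' {i}ᶜ)).minimalPrimes ∪ (Ideal.span (y '' {i}ᶜ)).minimalPrimes
  have hs : s.Finite := (Ideal.finite_minimalPrimes_of_isNoetherianRing _ _).union
    (Ideal.finite_minimalPrimes_of_isNoetherianRing _ _)
  have hprime : ∀ p ∈ s, p.IsPrime := by
    rintro p (hp | hp) <;> exact hp.isPrime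
  have hnot : ¬ ((maximalIdeal R : Set R) ⊆ ⋃ p ∈ hs.toFinset, (p : Set R)) := by
    intro h
    obtain ⟨p, hp, hle⟩ := (Ideal.subset_union_prime (s := hs.toFinset) (f := id) ⊥ ⊥
      (fun p hp _ _ ↦ hprime p (hs.mem_toFinset.1 hp))).1 h
    rw [hs.mem_toFinset] at hp
    obtain rfl : p = maximalIdeal R :=
      le_antisymm (le_maximalIdeal (hprime p hp).ne_top) hle
    rcases hp with hp | hp
    · exact hx.maximalIdeal_notMem_minimalPrimes i hp
    · exact hy.maximalIdeal_notMem_minimalPrimes i hp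
  obtain ⟨z, hz, hz'⟩ := Set.not_subset.1 hnot
  simp only [Set.mem_iUnion, hs.mem_toFinset, not_exists] at hz'
  exact ⟨z, hx.update hz fun p hp ↦ hz' p (.inl hp), hy.update hz fun p hp ↦ hz' p (.inr hp)⟩

end IsSOP

section Regular

variable {R : Type*} [CommRing R] {B : Type*} [CommRing B] [Algebra R B] {n : ℕ} {x : Fin n → R}

lemma isWeaklyRegular_ofFn_iff : RingTheory.Sequence.IsWeaklyRegular B (List.ofFn x) ↔
    ∀ i, NonzerodivisorMod (algebraMap R B (x i))
      (Ideal.span ((fun i ↦ algebraMap R B (x i)) '' Set.Iio i)) := by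
  rw [RingTheory.Sequence.isWeaklyRegular_iff_Fin,
    (finCongr (List.length_ofFn (f := x))).forall_congr]
  rintro ⟨i, hi⟩
  rw [List.length_ofFn] at hi
  rw [isSMulRegular_quotient_iff_mem_of_smul_mem, Ideal.smul_top_eq_map]
  have : (Ideal.ofList ((List.ofFn x).take i)).map (algebraMap R B) =
      Ideal.span ((fun i ↦ algebraMap R B (x i)) '' Set.Iio ⟨i, hi⟩) := by
    rw [Ideal.ofList, Ideal.map_span]
    congr 1
    ext b
    simp only [Set.mem_image, List.mem_take_iff_getElem, Set.mem_ofPred_eq, Set.mem_Iio]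
    constructor
    · rintro ⟨_, ⟨j, hj, rfl⟩, rfl⟩
      simp only [List.length_ofFn, lt_min_iff] at hj
      exact ⟨⟨j, hj.2⟩, hj.1, by simp⟩
    · rintro ⟨j, hj, rfl⟩
      exact ⟨_, ⟨j, by simpa using Fin.lt_def.1 hj, rfl⟩, by simp⟩
  simp only [finCongr_apply, Fin.cast_mk, this, Submodule.restrictScalars_mem,
    Fin.getElem_fin, List.getElem_ofFn, Algebra.smul_def]
  rfl

lemma IsRegSeq.powRegular (h : IsRegSeq R B x) :
    PowRegular fun i ↦ algebraMap R B (x i) := by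
  have h := isWeaklyRegular_ofFn_iff.1 h.toIsWeaklyRegular
  refine RegularMod.powRegular (l := List.finRange n) (.of_forall_append fun l₁ i l₂ hl ↦ ?_)
    (List.nodup_finRange n) (by simp)
  rw [bot_sup_eq]
  convert h i using 4
  ext j
  have hs : (List.finRange n).Pairwise (· < ·) := List.pairwise_lt_finRange n
  have hj := List.mem_finRange j
  rw [hl] at hs hj
  simp only [List.pairwise_append, List.pairwise_cons, List.mem_cons, List.mem_append] at hs hj
  simp only [Set.mem_ofPred_eq, Set.mem_Iio]
  grind

lemma PermRegular.isBigCM [IsLocalRing R] (hx : IsSOP R x)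
    (h : PermRegular fun i ↦ algebraMap R B (x i))
    (hB : (maximalIdeal R).map (algebraMap R B) ≠ ⊤) : IsBigCM R B := by
  refine ⟨⟨n, x, hx, ⟨isWeaklyRegular_ofFn_iff.2 fun i ↦ h _ i (by simp), fun htop ↦ hB ?_⟩⟩, hB⟩
  rw [Ideal.smul_top_eq_map] at htop
  have htop' : (Ideal.ofList (List.ofFn x)).map (algebraMap R B) = ⊤ :=
    (Submodule.restrictScalars_eq_top_iff R B B).1 htop.symm
  rw [eq_top_iff, ← htop']
  refine Ideal.map_mono (Ideal.span_le.2 ?_)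
  intro r hr
  obtain ⟨i, rfl⟩ := List.mem_ofFn.1 hr
  exact hx.2.1 i

end Regular

/-- `S` maps to an algebra in which the maximal ideal of `R` does not generate the unit ideal and
on which `x` is regular in any order. -/
def MapsToPermRegular {R : Type u} [CommRing R] [IsLocalRing R] (S : Type v) [CommRing S]
    [Algebra R S] {n : ℕ} (x : Fin n → R) : Prop :=
  ∃ (B : Type (max u v)) (_ : CommRing B) (_ : Algebra R B),
    (PermRegular fun i ↦ algebraMap R B (x i)) ∧ (maximalIdeal R).map (algebraMap R B) ≠ ⊤ ∧
      Nonempty (S →ₐ[R] B)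

section Seed

variable {R : Type u} [CommRing R] [IsLocalRing R] {S : Type v} [CommRing S] [Algebra R S] {n : ℕ}
  {x y : Fin n → R}

lemma PowRegular.mapsToPermRegular {B : Type (max u v)} [CommRing B] [Algebra R B]
    (hx : ∀ i, x i ∈ maximalIdeal R) (h : PowRegular fun i ↦ algebraMap R B (x i))
    (hB : (maximalIdeal R).map (algebraMap R B) ≠ ⊤) (φ : S →ₐ[R] B) : MapsToPermRegular S x :=
  ⟨LimitProduct Filter.atTop (fun _ : ℕ ↦ B) x, inferInstance, inferInstance,
    LimitProduct.permRegular Filter.tendsto_id fun _ ↦ h,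
    LimitProduct.map_ne_top hx fun _ ↦ hB,
    ⟨(Ideal.Quotient.mkₐ R _).comp (AlgHom.pi fun _ ↦ φ)⟩⟩

lemma MapsToPermRegular.isSeed (h : MapsToPermRegular S x) (hx : IsSOP R x) : IsSeed R S := by
  obtain ⟨B, _, _, hB, hB', hφ⟩ := h
  exact ⟨B, _, _, hB.isBigCM hx hB', hφ⟩

lemma MapsToPermRegular.update [IsNoetherianRing R] (h : MapsToPermRegular S x) {i : Fin n} {z : R}
    (hx : IsSOP R x) (hz : IsSOP R (Function.update x i z)) :
    MapsToPermRegular S (Function.update x i z) := by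
  obtain ⟨B, _, _, hB, hB', ⟨φ⟩⟩ := h
  have hi : x i ∈ (Ideal.span (Set.range (Function.update x i z))).radical := by
    rw [hz.2.2]; exact hx.2.1 i
  obtain ⟨N, hN⟩ := hi
  have himg : Function.update x i z '' {i}ᶜ = x '' {i}ᶜ :=
    Set.image_congr fun j hj ↦ Function.update_of_ne hj _ _
  rw [← Ideal.span_image_compl_sup_span _ i, himg, Function.update_self] at hN
  have hN' := Ideal.mem_map_of_mem (algebraMap R B) hN
  rw [Ideal.map_sup, Ideal.map_span, Ideal.map_span, Set.image_image, Set.image_singleton,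
    map_pow] at hN'
  refine PowRegular.mapsToPermRegular hz.2.1 ?_ hB' φ
  convert hB.powRegular_update hN' using 1
  ext j
  by_cases h : j = i
  · subst h; simp
  · simp [h]

lemma MapsToPermRegular.of_isSOP [IsNoetherianRing R] (h : MapsToPermRegular S x)
    (hx : IsSOP R x) (hy : IsSOP R y) : MapsToPermRegular S y := by
  classical
  induction hk : (Finset.univ.filter fun i ↦ x i ≠ y i).card using Nat.strong_induction_on
    generalizing x y with
  | _ k ih =>
  by_cases hxy : x = y
  · exact hxy ▸ h
  obtain ⟨i, hi⟩ := Function.ne_iff.1 hxy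
  obtain ⟨z, hxz, hyz⟩ := hx.exists_update_update hy i
  have hlt : (Finset.univ.filter fun j ↦ Function.update x i z j ≠ Function.update y i z j).card
      < k := by
    rw [← hk]
    refine Finset.card_lt_card ((Finset.ssubset_iff_of_subset fun j hj ↦ ?_).2 ⟨i, ?_, ?_⟩)
    · by_cases hji : j = i
      · subst hji; simp at hj
      · simpa [hji] using hj
    · simpa using hi
    · simp
  have := (ih _ hlt (h.update hx hxz) hxz hyz rfl).update (i := i) (z := y i) hyz (by simpa using hy)
  simpa using this

lemma IsSeed.mapsToPermRegular [IsNoetherianRing R] (h : IsSeed R S) (hy : IsSOP R y) :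
    MapsToPermRegular S y := by
  obtain ⟨B, _, _, ⟨⟨k, x, hx, hreg⟩, hB⟩, ⟨φ⟩⟩ := h
  obtain rfl : k = n := by exact_mod_cast hx.1.trans hy.1.symm
  exact (hreg.powRegular.mapsToPermRegular hx.2.1 hB φ).of_isSOP hx hy

lemma IsSeed.exists_isSOP (h : IsSeed R S) : ∃ (n : ℕ) (x : Fin n → R), IsSOP R x := by
  obtain ⟨B, _, _, ⟨⟨k, x, hx, -⟩, -⟩, -⟩ := h
  exact ⟨k, x, hx⟩

lemma IsSeed.of_algHom {S' : Type v} [CommRing S'] [Algebra R S'] (h : IsSeed R S')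
    (ψ : S →ₐ[R] S') : IsSeed R S := by
  obtain ⟨B, _, _, hB, ⟨φ⟩⟩ := h
  exact ⟨B, _, _, hB, ⟨φ.comp ψ⟩⟩

/-- The quotient by the union of a nonempty chain of ideals with seed quotients is a seed. -/
lemma isSeed_quotient_sSup [IsNoetherianRing R] {c : Set (Ideal S)} (hc : IsChain (· ≤ ·) c)
    (hne : c.Nonempty) (hseed : ∀ I ∈ c, IsSeed R (S ⧸ I)) : IsSeed R (S ⧸ sSup c) := by
  obtain ⟨I₀, hI₀⟩ := hne
  obtain ⟨n, x, hx⟩ := (hseed I₀ hI₀).exists_isSOP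
  have : Nonempty c := ⟨⟨I₀, hI₀⟩⟩
  have : IsDirectedOrder c := ⟨hc.directed⟩
  choose B _ _ hB hB' φ using fun I : c ↦ (hseed I I.2).mapsToPermRegular hx
  replace φ := fun I ↦ (φ I).some
  have : (Filter.atTop : Filter (c × ℕ)).NeBot := by
    rw [← Filter.prod_atTop_atTop_eq]; infer_instance
  let T := LimitProduct (Filter.atTop : Filter (c × ℕ)) (fun a ↦ B a.1) x
  let ψ : S →ₐ[R] T := (Ideal.Quotient.mkₐ R _).comp
    (AlgHom.pi fun a ↦ (φ a.1).comp (Ideal.Quotient.mkₐ R (a.1 : Ideal S)))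
  have hψ : ∀ s ∈ sSup c, ψ s = 0 := by
    suffices sSup c ≤ RingHom.ker ψ from this
    refine sSup_le fun I hI s hs ↦ ?_
    refine Ideal.Quotient.eq_zero_iff_mem.2 (mem_nullIdeal.2 fun m ↦ ?_)
    filter_upwards [Filter.eventually_ge_atTop ((⟨I, hI⟩, 0) : c × ℕ)] with a ha
    have : Ideal.Quotient.mkₐ R (a.1 : Ideal S) s = 0 :=
      Ideal.Quotient.eq_zero_iff_mem.2 (ha.1 hs)
    simp only [AlgHom.pi_apply, AlgHom.comp_apply, RingHom.coe_coe, this, map_zero,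
      Submodule.zero_mem]
  have hT : MapsToPermRegular (S ⧸ sSup c) x := by
    refine ⟨T, inferInstance, inferInstance,
      LimitProduct.permRegular (g := Prod.snd) ?_ fun a ↦ (hB a.1).powRegular,
      LimitProduct.map_ne_top hx.2.1 fun a ↦ hB' a.1, ⟨Ideal.Quotient.liftₐ _ ψ hψ⟩⟩
    rw [← Filter.prod_atTop_atTop_eq]
    exact Filter.tendsto_snd
  exact hT.isSeed hx

end Seed

/-- **Proposition (Dietz, Prop. 5.3 / `minseed`).** Let `(R,m)` be a Noetherian local ring
and let `S` be a seed over `R`. Then there is an ideal `I` of `S` such that `S/I` is a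
minimal seed over `R`. -/
theorem seed_maps_onto_minimal_seed
    (R : Type u) [CommRing R] [IsLocalRing R] [IsNoetherianRing R]
    (S : Type v) [CommRing S] [Algebra R S] (hS : IsSeed R S) :
    ∃ I : Ideal S, IsMinimalSeed R (S ⧸ I) := by
  have hbot : IsSeed R (S ⧸ (⊥ : Ideal S)) :=
    hS.of_algHom (Ideal.Quotient.liftₐ ⊥ (AlgHom.id R S) fun _ h ↦ h)
  obtain ⟨I, -, hI⟩ := zorn_le_nonempty₀ {I : Ideal S | IsSeed R (S ⧸ I)}
    (fun c hc hchain J hJ ↦ ⟨sSup c, isSeed_quotient_sSup hchain ⟨J, hJ⟩ hc, fun _ ↦ le_sSup⟩)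
    ⊥ hbot
  refine ⟨I, hI.prop, fun J hJ hseed ↦ hJ ?_⟩
  let q : S →ₐ[R] (S ⧸ I) ⧸ J := (Ideal.Quotient.mkₐ R J).comp (Ideal.Quotient.mkₐ R I)
  have hker : IsSeed R (S ⧸ J.comap (Ideal.Quotient.mk I)) :=
    hseed.of_algHom (Ideal.Quotient.liftₐ _ q fun _ h ↦ Ideal.Quotient.eq_zero_iff_mem.2 h)
  have hle : I ≤ J.comap (Ideal.Quotient.mk I) := fun s hs ↦ by
    rw [Ideal.mem_comap, Ideal.Quotient.eq_zero_iff_mem.2 hs]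
    exact J.zero_mem
  have hge := hI.le_of_ge hker hle
  rw [eq_bot_iff]
  intro b hb
  obtain ⟨s, rfl⟩ := Ideal.Quotient.mk_surjective b
  exact Ideal.Quotient.eq_zero_iff_mem.2 (hge hb)
end
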